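/- arXiv:1112.0792 — 3 statements merged into one kernel-verified Lean document; each statement's English description precedes it below -/
import Mathlib

section
/- Let R, R₁, R₂ be unital associative K-algebras such that T(R) = T(R₁)·T(R₂) (product of ideals in K⟨X⟩). Then for every d ≥ 1 the Hilbert series of the intersections with K⟨X_d⟩ satisfy (1 − (t₁+⋯+t_d))^{−1} · H(K⟨X_d⟩ ∩ T(R); t₁,…,t_d) = H(K⟨X_d⟩ ∩ T(R₁); t₁,…,t_d) · H(K⟨X_d⟩ ∩ T(R₂); t₁,…,t_d) as formal power series. -/
open scoped BigOperators
open MvPowerSeries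

noncomputable section

variable (K : Type*) [Field K] [CharZero K]

/-- The T-ideal of polynomial identities of a unital associative `K`-algebra `R`,
as a subspace (in fact a two-sided ideal) of the free associative algebra
`K⟨x₀,x₁,…⟩` on countably many generators. -/
def Tideal (R : Type*) [Ring R] [Algebra K R] : Submodule K (FreeAlgebra K ℕ) :=
  ⨅ φ : FreeAlgebra K ℕ →ₐ[K] R, LinearMap.ker φ.toLinearMap

/-- The canonical embedding `K⟨x₁,…,x_d⟩ → K⟨x₁,x₂,…⟩`. -/
def embedFree (d : ℕ) : FreeAlgebra K (Fin d) →ₐ[K] FreeAlgebra K ℕ :=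
  FreeAlgebra.lift K fun i => FreeAlgebra.ι K (i : ℕ)

/-- `K⟨X_d⟩ ∩ T(R)`, realized inside the free algebra of rank `d`. -/
def TidealD (d : ℕ) (R : Type*) [Ring R] [Algebra K R] :
    Submodule K (FreeAlgebra K (Fin d)) :=
  (Tideal K R).comap (embedFree K d).toLinearMap

/-- The multihomogeneous component of multidegree `ν` of the free algebra of rank `d`:
the span of all products of generators in which `x_i` occurs exactly `ν i` times. -/
def homComponent (d : ℕ) (ν : Fin d →₀ ℕ) : Submodule K (FreeAlgebra K (Fin d)) :=
  Submodule.span K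
    {x | ∃ w : List (Fin d), (∀ i, w.count i = ν i) ∧ x = (w.map (FreeAlgebra.ι K)).prod}

/-- Hilbert series of a multihomogeneous subspace `W ⊆ K⟨X_d⟩`. -/
def hilbertSeriesOf (d : ℕ) (W : Submodule K (FreeAlgebra K (Fin d))) :
    MvPowerSeries (Fin d) ℚ :=
  fun ν => (Module.finrank K ↥(W ⊓ homComponent K d ν) : ℚ)

/-- Hilbert series of the relatively free algebra `F_d(R) = K⟨X_d⟩/(K⟨X_d⟩ ∩ T(R))`,
with its induced multigrading. -/
def relFreeHilbert (d : ℕ) (R : Type*) [Ring R] [Algebra K R] :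
    MvPowerSeries (Fin d) ℚ :=
  fun ν => (Module.finrank K ↥((homComponent K d ν).map (TidealD K d R).mkQ) : ℚ)

end

namespace Formanek

open Module

set_option linter.unusedSectionVars false

variable {K : Type*} [Field K] [CharZero K] {d : ℕ}

/-- the monomial basis -/
noncomputable def e (K : Type*) [Field K] (d : ℕ) :
    Basis (FreeMonoid (Fin d)) K (FreeAlgebra K (Fin d)) :=
  FreeAlgebra.basisFreeMonoid K (Fin d)

theorem e_eq (w : FreeMonoid (Fin d)) :
    e K d w = FreeMonoid.lift (FreeAlgebra.ι K) w := by
  simp [e, FreeAlgebra.basisFreeMonoid, FreeAlgebra.equivMonoidAlgebraFreeMonoid]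

theorem e_mul (w v : FreeMonoid (Fin d)) : e K d (w * v) = e K d w * e K d v := by
  simp [e_eq]

theorem e_one : e K d 1 = 1 := by
  simp [e_eq]

theorem e_of (i : Fin d) : e K d (FreeMonoid.of i) = FreeAlgebra.ι K i := by
  simp [e_eq]

theorem e_ind {P : Submodule K (FreeAlgebra K (Fin d))} (h : ∀ w, e K d w ∈ P)
    (x : FreeAlgebra K (Fin d)) : x ∈ P := by
  have : (⊤ : Submodule K (FreeAlgebra K (Fin d))) ≤ P := by
    rw [← (e K d).span_eq, Submodule.span_le]
    rintro _ ⟨w, rfl⟩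
    exact h w
  exact this trivial

/-- multidegree of a word -/
noncomputable def dg (w : FreeMonoid (Fin d)) : Fin d →₀ ℕ :=
  Finsupp.equivFunOnFinite.symm fun i => w.toList.count i

theorem dg_mul (w v : FreeMonoid (Fin d)) : dg (w * v) = dg w + dg v := by
  ext i
  simp [dg]

theorem dg_one : dg (1 : FreeMonoid (Fin d)) = 0 := by
  ext i
  simp [dg]

theorem dg_of (i : Fin d) : dg (FreeMonoid.of i) = Finsupp.single i 1 := by
  ext j
  simp [dg, Finsupp.single_apply, List.count_singleton]

/-- projection to the component -/
noncomputable def pr (K : Type*) [Field K] (d : ℕ) (ν : Fin d →₀ ℕ) :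
    FreeAlgebra K (Fin d) →ₗ[K] FreeAlgebra K (Fin d) :=
  (e K d).constr K fun w => if dg w = ν then e K d w else 0

theorem pr_e (ν : Fin d →₀ ℕ) (w : FreeMonoid (Fin d)) :
    pr K d ν (e K d w) = if dg w = ν then e K d w else 0 := by
  simp only [pr, Basis.constr_basis]

theorem hom_eq (ν : Fin d →₀ ℕ) :
    homComponent K d ν = Submodule.span K (e K d '' {w | dg w = ν}) := by
  unfold homComponent
  congr 1
  ext x
  constructor
  · rintro ⟨w, hw, rfl⟩
    refine ⟨FreeMonoid.ofList w, ?_, ?_⟩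
    · ext i
      simp [dg, hw]
    · simp [e_eq, FreeMonoid.lift_apply]
  · rintro ⟨w, rfl, rfl⟩
    refine ⟨w.toList, fun i => ?_, ?_⟩
    · simp [dg]
    · simp [e_eq, FreeMonoid.lift_apply]

theorem e_mem_hom (w : FreeMonoid (Fin d)) : e K d w ∈ homComponent K d (dg w) := by
  rw [hom_eq]
  exact Submodule.subset_span ⟨w, rfl, rfl⟩

instance hom_fin (ν : Fin d →₀ ℕ) : FiniteDimensional K (homComponent K d ν) := by
  rw [hom_eq]
  apply FiniteDimensional.span_of_finite
  apply Set.Finite.image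
  have := List.finite_length_eq (Fin d) (∑ i, ν i)
  refine this.subset ?_
  intro w hw
  obtain rfl : dg w = ν := hw
  show List.length (FreeMonoid.toList w) = _
  have := Multiset.sum_count_eq_card (s := Finset.univ) (m := (FreeMonoid.toList w : Multiset (Fin d)))
    (by simp)
  simp at this
  simp [dg, this]

instance inf_hom_fin (A : Submodule K (FreeAlgebra K (Fin d))) (ν : Fin d →₀ ℕ) :
    FiniteDimensional K ↥(A ⊓ homComponent K d ν) :=
  Submodule.finiteDimensional_of_le inf_le_right

theorem pr_mem (ν : Fin d →₀ ℕ) (x : FreeAlgebra K (Fin d)) :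
    pr K d ν x ∈ homComponent K d ν := by
  refine e_ind (P := (homComponent K d ν).comap (pr K d ν)) (fun w => ?_) x
  rw [Submodule.mem_comap, pr_e]
  split_ifs with h
  · subst h
    exact e_mem_hom w
  · exact zero_mem _

theorem pr_of_mem {μ : Fin d →₀ ℕ} (ν : Fin d →₀ ℕ) {x : FreeAlgebra K (Fin d)}
    (hx : x ∈ homComponent K d μ) : pr K d ν x = if μ = ν then x else 0 := by
  rw [hom_eq] at hx
  induction hx using Submodule.span_induction with
  | mem x h =>
    obtain ⟨w, rfl, rfl⟩ := h
    exact pr_e _ _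
  | zero => simp
  | add x y _ _ hx hy =>
    rw [map_add, hx, hy]
    split_ifs <;> simp
  | smul c x _ hx =>
    rw [map_smul, hx]
    split_ifs <;> simp

theorem pr_self {ν : Fin d →₀ ℕ} {x : FreeAlgebra K (Fin d)}
    (hx : x ∈ homComponent K d ν) : pr K d ν x = x := by
  rw [pr_of_mem ν hx, if_pos rfl]

theorem exists_sum_pr (x : FreeAlgebra K (Fin d)) :
    ∃ s : Finset (Fin d →₀ ℕ), ∑ ν ∈ s, pr K d ν x = x := by
  classical
  suffices h : ∃ s : Finset (Fin d →₀ ℕ), ∀ t, s ⊆ t → ∑ ν ∈ t, pr K d ν x = x by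
    obtain ⟨s, hs⟩ := h
    exact ⟨s, hs s subset_rfl⟩
  have hx : x ∈ Submodule.span K (Set.range (e K d)) := by
    rw [(e K d).span_eq]; trivial
  induction hx using Submodule.span_induction with
  | mem x h =>
    obtain ⟨w, rfl⟩ := h
    refine ⟨{dg w}, fun t ht => ?_⟩
    simp only [pr_e]
    rw [Finset.sum_ite_eq, if_pos (ht (by simp))]
  | zero => exact ⟨∅, by simp⟩
  | add x y _ _ hx hy =>
    obtain ⟨s, hs⟩ := hx
    obtain ⟨s', hs'⟩ := hy
    refine ⟨s ∪ s', fun t ht => ?_⟩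
    simp only [map_add, Finset.sum_add_distrib]
    rw [hs t (Finset.union_subset_left ht), hs' t (Finset.union_subset_right ht)]
  | smul c x _ hx =>
    obtain ⟨s, hs⟩ := hx
    refine ⟨s, fun t ht => ?_⟩
    simp only [map_smul, ← Finset.smul_sum]
    rw [hs t ht]

theorem hom_mul {μ l : Fin d →₀ ℕ} {x y : FreeAlgebra K (Fin d)}
    (hx : x ∈ homComponent K d μ) (hy : y ∈ homComponent K d l) :
    x * y ∈ homComponent K d (μ + l) := by
  have h : homComponent K d μ * homComponent K d l ≤ homComponent K d (μ + l) := by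
    rw [hom_eq μ, hom_eq l, Submodule.span_mul_span, Submodule.span_le]
    rintro _ ⟨_, ⟨w, rfl, rfl⟩, _, ⟨v, rfl, rfl⟩, rfl⟩
    simp only [← e_mul, ← dg_mul]
    exact e_mem_hom _
  exact h (Submodule.mul_mem_mul hx hy)

/-- multihomogeneous subspaces -/
def Gr (A : Submodule K (FreeAlgebra K (Fin d))) : Prop :=
  ∀ ν, ∀ x ∈ A, pr K d ν x ∈ A

theorem pr_mul_mem {A C : Submodule K (FreeAlgebra K (Fin d))} (hA : Gr A) (hC : Gr C)
    (ν : Fin d →₀ ℕ) {x : FreeAlgebra K (Fin d)} (hx : x ∈ A * C) :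
    pr K d ν x ∈ ⨆ p : Finset.HasAntidiagonal.antidiagonal ν,
      (A ⊓ homComponent K d p.1.1) * (C ⊓ homComponent K d p.1.2) := by
  induction hx using Submodule.mul_induction_on' with
  | add x _ y _ hx hy =>
    rw [map_add]
    exact add_mem hx hy
  | mem_mul_mem a ha c hc =>
    obtain ⟨s, hs⟩ := exists_sum_pr a
    obtain ⟨t, ht⟩ := exists_sum_pr c
    rw [← hs, ← ht, Finset.sum_mul_sum, map_sum]
    refine sum_mem fun μ _ => ?_
    rw [map_sum]
    refine sum_mem fun l _ => ?_
    rw [pr_of_mem ν (hom_mul (pr_mem μ a) (pr_mem l c))]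
    split_ifs with h
    · refine Submodule.mem_iSup_of_mem ⟨(μ, l), by simpa using h⟩ ?_
      exact Submodule.mul_mem_mul ⟨hA _ _ ha, pr_mem _ _⟩ ⟨hC _ _ hc, pr_mem _ _⟩
    · exact zero_mem _

theorem mul_inf_hom {A C : Submodule K (FreeAlgebra K (Fin d))} (hA : Gr A) (hC : Gr C)
    (ν : Fin d →₀ ℕ) :
    (A * C) ⊓ homComponent K d ν = ⨆ p : Finset.HasAntidiagonal.antidiagonal ν,
      (A ⊓ homComponent K d p.1.1) * (C ⊓ homComponent K d p.1.2) := by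
  apply le_antisymm
  · rintro x ⟨hx, hν⟩
    rw [← pr_self hν]
    exact pr_mul_mem hA hC ν hx
  · refine iSup_le fun p => le_inf (mul_le_mul' inf_le_left inf_le_left) ?_
    rw [Submodule.mul_le]
    rintro a ⟨_, ha⟩ c ⟨_, hc⟩
    have := p.2
    rw [Finset.HasAntidiagonal.mem_antidiagonal] at this
    rw [← this]
    exact hom_mul ha hc

theorem gr_mul {A C : Submodule K (FreeAlgebra K (Fin d))} (hA : Gr A) (hC : Gr C) :
    Gr (A * C) := by
  intro ν x hx
  have := pr_mul_mem hA hC ν hx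
  rw [← mul_inf_hom hA hC] at this
  exact this.1

/-- A basis of the homogeneous component of a subspace -/
noncomputable def bs (A : Submodule K (FreeAlgebra K (Fin d))) (ν : Fin d →₀ ℕ) :
    Basis (Fin (finrank K ↥(A ⊓ homComponent K d ν))) K ↥(A ⊓ homComponent K d ν) :=
  Module.finBasis K _

theorem span_bs (A : Submodule K (FreeAlgebra K (Fin d))) (ν : Fin d →₀ ℕ) :
    Submodule.span K (Set.range fun i => (bs A ν i : FreeAlgebra K (Fin d))) =
      A ⊓ homComponent K d ν := by
  have := congrArg (Submodule.map (A ⊓ homComponent K d ν).subtype) (bs A ν).span_eq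
  rw [Submodule.map_span, Submodule.map_top, Submodule.range_subtype, ← Set.range_comp] at this
  exact this

theorem pr_iSup {B : (Fin d →₀ ℕ) → Submodule K (FreeAlgebra K (Fin d))}
    (hB : ∀ ν, B ν ≤ homComponent K d ν) {x} (hx : x ∈ ⨆ ν, B ν) (ν) : pr K d ν x ∈ B ν := by
  refine Submodule.iSup_induction _ (motive := fun x => pr K d ν x ∈ B ν) hx
    (fun μ x h => ?_) (by simp) fun x y hx hy => ?_
  · rw [pr_of_mem ν (hB μ h)]
    split_ifs with h'
    · exact h' ▸ h
    · exact zero_mem _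
  · rw [map_add]
    exact add_mem hx hy

theorem linInd_bs (A : Submodule K (FreeAlgebra K (Fin d))) :
    LinearIndependent K fun p : (Σ ν, Fin (finrank K ↥(A ⊓ homComponent K d ν))) =>
      (bs A p.1 p.2 : FreeAlgebra K (Fin d)) := by
  refine linearIndependent_iUnion_finite
    (f := fun ν i => (bs A ν i : FreeAlgebra K (Fin d))) (fun ν => ?_) fun ν t _ hν => ?_
  · exact (bs A ν).linearIndependent.map' (A ⊓ homComponent K d ν).subtype (by simp)
  · simp only [span_bs]
    rw [Submodule.disjoint_def]
    rintro x ⟨_, hx⟩ hx'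
    have h : x ∈ ⨆ μ, ⨆ (_ : μ ∈ t), (A ⊓ homComponent K d μ) := hx'
    have := pr_iSup (fun μ => iSup_le fun _ => inf_le_right) h ν
    rw [pr_self hx] at this
    simpa [hν] using this

theorem hilb_mul {A C : Submodule K (FreeAlgebra K (Fin d))} (hA : Gr A) (hC : Gr C)
    (h : A.LinearDisjoint C) :
    hilbertSeriesOf K d (A * C) = hilbertSeriesOf K d A * hilbertSeriesOf K d C := by
  classical
  ext ν
  rw [MvPowerSeries.coeff_mul]
  show (finrank K ↥((A * C) ⊓ homComponent K d ν) : ℚ) = ∑ p ∈ Finset.HasAntidiagonal.antidiagonal ν,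
    (finrank K ↥(A ⊓ homComponent K d p.1) : ℚ) * (finrank K ↥(C ⊓ homComponent K d p.2) : ℚ)
  let a : (Σ ν, Fin (finrank K ↥(A ⊓ homComponent K d ν))) → A :=
    fun p => ⟨bs A p.1 p.2, (bs A p.1 p.2).2.1⟩
  let c : (Σ ν, Fin (finrank K ↥(C ⊓ homComponent K d ν))) → C :=
    fun p => ⟨bs C p.1 p.2, (bs C p.1 p.2).2.1⟩
  have ha : LinearIndependent K a := LinearIndependent.of_comp A.subtype (linInd_bs A)
  have hc : LinearIndependent K c := LinearIndependent.of_comp C.subtype (linInd_bs C)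
  have hac := h.linearIndependent_mul_of_flat (Or.inl inferInstance) ha hc
  let g : (Σ p : Finset.HasAntidiagonal.antidiagonal ν, Fin (finrank K ↥(A ⊓ homComponent K d p.1.1)) ×
      Fin (finrank K ↥(C ⊓ homComponent K d p.1.2))) →
      (Σ ν, Fin (finrank K ↥(A ⊓ homComponent K d ν))) ×
      (Σ ν, Fin (finrank K ↥(C ⊓ homComponent K d ν))) :=
    fun q => (⟨_, q.2.1⟩, ⟨_, q.2.2⟩)
  have hg : Function.Injective g := by
    rintro ⟨⟨⟨p1, p2⟩, hp⟩, i, j⟩ ⟨⟨⟨q1, q2⟩, hq⟩, k, l⟩ hh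
    simp only [g, Prod.mk.injEq, Sigma.mk.injEq] at hh
    obtain ⟨⟨rfl, h1⟩, ⟨rfl, h2⟩⟩ := hh
    rw [heq_iff_eq] at h1 h2
    subst h1 h2
    rfl
  have hli := hac.comp g hg
  have hsp : (A * C) ⊓ homComponent K d ν = Submodule.span K
      (Set.range ((fun i : _ × _ => ((a i.1 : A) : FreeAlgebra K (Fin d)) * (c i.2 : C)) ∘ g)) := by
    rw [mul_inf_hom hA hC]
    simp only [← span_bs, Submodule.span_mul_span, ← Submodule.span_iUnion]
    congr 1
    ext x
    simp only [Set.mem_iUnion, Set.mem_mul, Set.mem_range]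
    constructor
    · rintro ⟨p, _, ⟨i, rfl⟩, _, ⟨j, rfl⟩, rfl⟩
      exact ⟨⟨p, i, j⟩, rfl⟩
    · rintro ⟨⟨p, i, j⟩, rfl⟩
      exact ⟨p, _, ⟨i, rfl⟩, _, ⟨j, rfl⟩, rfl⟩
  rw [hsp, finrank_span_eq_card hli, Fintype.card_sigma]
  simp only [Fintype.card_prod, Fintype.card_fin]
  push_cast
  exact Finset.sum_coe_sort (Finset.HasAntidiagonal.antidiagonal ν) (fun p => 
    (finrank K ↥(A ⊓ homComponent K d p.1) : ℚ) * (finrank K ↥(C ⊓ homComponent K d p.2) : ℚ))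

/-- right partial derivative: removes a final letter `k` -/
noncomputable def rd (K : Type*) [Field K] (d : ℕ) (k : Fin d) :
    FreeAlgebra K (Fin d) →ₗ[K] FreeAlgebra K (Fin d) :=
  (e K d).constr K fun w =>
    if w.toList.getLast? = some k then e K d (FreeMonoid.ofList w.toList.dropLast) else 0

theorem rd_one (k : Fin d) : rd K d k 1 = 0 := by
  rw [← e_one, rd, Basis.constr_basis]
  simp

theorem rd_e_mul (k j : Fin d) (w : FreeMonoid (Fin d)) :
    rd K d k (e K d (w * FreeMonoid.of j)) = if j = k then e K d w else 0 := by
  rw [rd, Basis.constr_basis]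
  simp

theorem rd_mul (k j : Fin d) (u : FreeAlgebra K (Fin d)) :
    rd K d k (u * FreeAlgebra.ι K j) = if j = k then u else 0 := by
  have h : (rd K d k) ∘ₗ (LinearMap.mulRight K (FreeAlgebra.ι K j)) =
      if j = k then LinearMap.id else 0 := by
    refine (e K d).ext fun w => ?_
    simp only [LinearMap.comp_apply, LinearMap.mulRight_apply]
    rw [← e_of, ← e_mul, rd_e_mul]
    split_ifs <;> simp
  have := LinearMap.congr_fun h u
  simp only [LinearMap.comp_apply, LinearMap.mulRight_apply] at this
  rw [this]
  split_ifs <;> simp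

/-- constant term -/
noncomputable def ep (K : Type*) [Field K] (d : ℕ) : FreeAlgebra K (Fin d) →ₗ[K] K :=
  (e K d).coord 1

theorem word_cases (w : FreeMonoid (Fin d)) :
    w = 1 ∨ ∃ (v : FreeMonoid (Fin d)) (k : Fin d), w = v * FreeMonoid.of k := by
  rcases List.eq_nil_or_concat (FreeMonoid.toList w) with h | ⟨v, k, h⟩
  · left
    exact h
  · right
    exact ⟨FreeMonoid.ofList v, k, by
      apply FreeMonoid.toList.injective
      simpa using h⟩

theorem mul_of_ne_one (v : FreeMonoid (Fin d)) (k : Fin d) : v * FreeMonoid.of k ≠ 1 := by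
  intro h
  have := congrArg FreeMonoid.length h
  simp at this

theorem decomp (f : FreeAlgebra K (Fin d)) :
    f = ep K d f • 1 + ∑ k, rd K d k f * FreeAlgebra.ι K k := by
  have h : LinearMap.id = (ep K d).smulRight (1 : FreeAlgebra K (Fin d)) +
      ∑ k, LinearMap.mulRight K (FreeAlgebra.ι K k) ∘ₗ rd K d k := by
    refine (e K d).ext fun w => ?_
    simp only [LinearMap.add_apply, LinearMap.smulRight_apply, LinearMap.sum_apply,
      LinearMap.comp_apply, LinearMap.mulRight_apply, LinearMap.id_apply]
    rcases word_cases w with rfl | ⟨v, k, rfl⟩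
    · have h1 : ep K d (e K d 1) = 1 := by simp [ep]
      have h2 : ∀ k, rd K d k (e K d 1) = 0 := fun k => by rw [e_one, rd_one]
      simp [h1, h2]
      exact e_one
    · simp only [rd_e_mul]
      rw [e_mul, e_of]
      simp [ep, Finsupp.single_apply, mul_of_ne_one, ← e_of, ← e_mul]
  have := LinearMap.congr_fun h f
  simpa using this

theorem repr_rd (k : Fin d) (f : FreeAlgebra K (Fin d)) (w : FreeMonoid (Fin d)) :
    (e K d).repr (rd K d k f) w = (e K d).repr f (w * FreeMonoid.of k) := by
  have h : (e K d).coord w ∘ₗ rd K d k = (e K d).coord (w * FreeMonoid.of k) := by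
    refine (e K d).ext fun v => ?_
    rcases word_cases v with rfl | ⟨v, j, rfl⟩
    · simp [e_one, rd_one]
      simp [← e_one, Finsupp.single_apply, (mul_of_ne_one _ _).symm]
    · simp only [LinearMap.comp_apply, rd_e_mul]
      by_cases hj : j = k
      · subst hj
        have hiff : v * FreeMonoid.of j = w * FreeMonoid.of j ↔ v = w := mul_left_inj _
        classical simp [Finsupp.single_apply, hiff]
      · have : v * FreeMonoid.of j ≠ w * FreeMonoid.of k := by
          intro h
          have := congrArg (fun w => (FreeMonoid.toList w).getLast?) h
          simp at this
          exact hj this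
        simp [hj, Finsupp.single_apply, this]
  exact LinearMap.congr_fun h f

/-- span of generators -/
noncomputable def V (K : Type*) [Field K] (d : ℕ) : Submodule K (FreeAlgebra K (Fin d)) :=
  Submodule.span K (Set.range (FreeAlgebra.ι K))

theorem pr_ι (ν : Fin d →₀ ℕ) (i : Fin d) :
    pr K d ν (FreeAlgebra.ι K i) = if Finsupp.single i 1 = ν then FreeAlgebra.ι K i else 0 := by
  rw [← e_of, pr_e, dg_of]

theorem pr_V (ν : Fin d →₀ ℕ) {x : FreeAlgebra K (Fin d)} (hx : x ∈ V K d) :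
    pr K d ν x ∈ Submodule.span K {x | ∃ i, Finsupp.single i 1 = ν ∧ x = FreeAlgebra.ι K i} := by
  have : V K d ≤ (Submodule.span K
      {x | ∃ i, Finsupp.single i 1 = ν ∧ x = FreeAlgebra.ι K i}).comap (pr K d ν) := by
    rw [V, Submodule.span_le]
    rintro _ ⟨i, rfl⟩
    rw [SetLike.mem_coe, Submodule.mem_comap, pr_ι]
    split_ifs with h
    · exact Submodule.subset_span ⟨i, h, rfl⟩
    · exact zero_mem _
  exact this hx

theorem V_inf (ν : Fin d →₀ ℕ) : V K d ⊓ homComponent K d ν =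
    Submodule.span K {x | ∃ i, Finsupp.single i 1 = ν ∧ x = FreeAlgebra.ι K i} := by
  apply le_antisymm
  · rintro x ⟨hx, hν⟩
    rw [← pr_self hν]
    exact pr_V ν hx
  · rw [Submodule.span_le]
    rintro _ ⟨i, rfl, rfl⟩
    refine ⟨Submodule.subset_span ⟨i, rfl⟩, ?_⟩
    rw [← e_of, ← dg_of]
    exact e_mem_hom _

theorem gr_V : Gr (V K d) := by
  intro ν x hx
  have := pr_V ν hx
  rw [← V_inf] at this
  exact this.1

theorem hilb_V : hilbertSeriesOf K d (V K d) = ∑ i : Fin d, MvPowerSeries.X i := by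
  classical
  ext ν
  rw [map_sum]
  simp only [MvPowerSeries.coeff_X]
  show (finrank K ↥(V K d ⊓ homComponent K d ν) : ℚ) = _
  rw [V_inf]
  by_cases h : ∃ i : Fin d, Finsupp.single i 1 = ν
  · obtain ⟨i, rfl⟩ := h
    have h1 : {x : FreeAlgebra K (Fin d) | ∃ j, (Finsupp.single j 1 : Fin d →₀ ℕ) =
        Finsupp.single i 1 ∧ x = FreeAlgebra.ι K j} = {FreeAlgebra.ι K i} := by
      ext x
      simp [Finsupp.single_left_inj]
    rw [h1, finrank_span_singleton (FreeAlgebra.ι_ne_zero i)]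
    simp [Finsupp.single_left_inj]
  · push Not at h
    have h1 : {x : FreeAlgebra K (Fin d) | ∃ j, (Finsupp.single j 1 : Fin d →₀ ℕ) =
        ν ∧ x = FreeAlgebra.ι K j} = ∅ := by
      ext x
      simp [h]
    rw [h1, Submodule.span_empty, finrank_bot]
    simp [fun i => (h i).symm]

theorem disj_V (I : Submodule K (FreeAlgebra K (Fin d))) : I.LinearDisjoint (V K d) := by
  have hli : LinearIndependent K (FreeAlgebra.ι K : Fin d → FreeAlgebra K (Fin d)) := by
    have := (e K d).linearIndependent.comp FreeMonoid.of FreeMonoid.of_injective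
    convert this using 1
    ext i
    simp [e_of]
  refine Submodule.LinearDisjoint.of_basis_right' I (V K d) (Basis.span hli) ?_
  rw [injective_iff_map_eq_zero]
  intro f hf
  rw [Submodule.mulRightMap_apply, Finsupp.sum_fintype _ _ (by simp)] at hf
  have hbs : ∀ i, ((Basis.span hli i : _) : FreeAlgebra K (Fin d)) = FreeAlgebra.ι K i :=
    fun i => congrArg Subtype.val (Basis.span_apply hli i)
  have hf : ∑ i, (f i : FreeAlgebra K (Fin d)) * FreeAlgebra.ι K i = 0 := by
    rw [← hf]
    exact Finset.sum_congr rfl fun i _ => by rw [← hbs i]; rfl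
  ext k
  have := congrArg (rd K d k) hf
  simpa [rd_mul] using this

theorem disj_B {I B : Submodule K (FreeAlgebra K (Fin d))} (hI : ∀ x ∈ I, ∀ y, x * y ∈ I)
    (hB : B ≤ I) (hd : B ⊓ (I * V K d) = ⊥) (C : Submodule K (FreeAlgebra K (Fin d))) :
    B.LinearDisjoint C := by
  let b := Basis.ofVectorSpace K B
  refine Submodule.LinearDisjoint.of_basis_left' B C b ?_
  rw [injective_iff_map_eq_zero]
  intro f hf
  rw [Submodule.mulLeftMap_apply, Finsupp.sum] at hf
  have step : ∀ g : _ → FreeAlgebra K (Fin d),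
      ∑ i ∈ f.support, (b i : FreeAlgebra K (Fin d)) * g i = 0 →
      (∀ i ∈ f.support, ep K d (g i) = 0) ∧
        ∀ k, ∑ i ∈ f.support, (b i : FreeAlgebra K (Fin d)) * rd K d k (g i) = 0 := by
    intro g hg
    have h1 : ∑ i ∈ f.support, (b i : FreeAlgebra K (Fin d)) * g i =
        ((∑ i ∈ f.support, ep K d (g i) • b i : B) : FreeAlgebra K (Fin d)) +
        ∑ k, (∑ i ∈ f.support, (b i : FreeAlgebra K (Fin d)) * rd K d k (g i)) *
          FreeAlgebra.ι K k := by
      simp only [Finset.sum_mul]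
      rw [Finset.sum_comm]
      push_cast
      rw [← Finset.sum_add_distrib]
      refine Finset.sum_congr rfl fun i _ => ?_
      conv_lhs => rw [decomp (g i)]
      simp [mul_add, Finset.mul_sum, mul_assoc]
    rw [hg] at h1
    have h2 : ∑ k, (∑ i ∈ f.support, (b i : FreeAlgebra K (Fin d)) * rd K d k (g i)) *
          FreeAlgebra.ι K k ∈ I * V K d := by
      refine sum_mem fun k _ => Submodule.mul_mem_mul (sum_mem fun i _ => ?_)
        (Submodule.subset_span ⟨k, rfl⟩)
      exact hI _ (hB (b i).2) _
    have h3 : (∑ i ∈ f.support, ep K d (g i) • b i : B) = 0 := by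
      have : ((∑ i ∈ f.support, ep K d (g i) • b i : B) : FreeAlgebra K (Fin d)) ∈
          B ⊓ (I * V K d) := by
        refine ⟨Subtype.property _, ?_⟩
        rw [eq_neg_of_add_eq_zero_left h1.symm]
        exact neg_mem h2
      rw [hd, Submodule.mem_bot] at this
      exact Subtype.ext this
    refine ⟨linearIndependent_iff'.1 b.linearIndependent _ _ h3, fun k => ?_⟩
    rw [h3] at h1
    have := congrArg (rd K d k) h1
    simp only [map_zero, ZeroMemClass.coe_zero, zero_add, map_sum, rd_mul] at this
    simpa using this.symm
  have key : ∀ (w : List (Fin d)) (g : _ → FreeAlgebra K (Fin d)),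
      ∑ i ∈ f.support, (b i : FreeAlgebra K (Fin d)) * g i = 0 →
      ∀ i ∈ f.support, (e K d).repr (g i) (FreeMonoid.ofList w) = 0 := by
    intro w
    induction w using List.reverseRecOn with
    | nil =>
      intro g hg i hi
      exact (step g hg).1 i hi
    | append_singleton w k ih =>
      intro g hg i hi
      have := ih _ ((step g hg).2 k) i hi
      rw [repr_rd] at this
      exact this
  by_contra hne
  obtain ⟨i, hi⟩ := Finsupp.support_nonempty_iff.2 hne
  have h0 : ((f i : C) : FreeAlgebra K (Fin d)) = 0 := by
    apply (e K d).repr.injective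
    ext w
    rw [map_zero]
    exact key (FreeMonoid.toList w) (fun i => (f i : C)) hf i hi
  rw [Finsupp.mem_support_iff] at hi
  exact hi (Subtype.ext h0)

theorem exists_B {I : Submodule K (FreeAlgebra K (Fin d))} (hI : ∀ x ∈ I, ∀ y, x * y ∈ I)
    (hG : Gr I) : ∃ B : Submodule K (FreeAlgebra K (Fin d)), Gr B ∧ B ≤ I ∧
      B ⊓ (I * V K d) = ⊥ ∧ ∀ ν, (I * V K d ⊓ homComponent K d ν) ⊔ (B ⊓ homComponent K d ν) =
        I ⊓ homComponent K d ν := by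
  have hIV : I * V K d ≤ I := Submodule.mul_le.2 fun x hx y _ => hI x hx y
  have hGV : Gr (I * V K d) := gr_mul hG gr_V
  choose Q hQ using fun ν => exists_isCompl (I * V K d ⊓ homComponent K d ν)
  let Bn : (Fin d →₀ ℕ) → Submodule K (FreeAlgebra K (Fin d)) :=
    fun ν => Q ν ⊓ (I ⊓ homComponent K d ν)
  have hBn : ∀ ν, Bn ν ≤ homComponent K d ν := fun ν => inf_le_right.trans inf_le_right
  have hGB : Gr (⨆ ν, Bn ν) := fun ν x hx =>
    Submodule.mem_iSup_of_mem ν (pr_iSup hBn hx ν)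
  have hBh : ∀ ν, (⨆ ν, Bn ν) ⊓ homComponent K d ν = Bn ν := by
    intro ν
    refine le_antisymm ?_ (le_inf (le_iSup Bn ν) (hBn ν))
    rintro x ⟨hx, hν⟩
    rw [← pr_self hν]
    exact pr_iSup hBn hx ν
  refine ⟨⨆ ν, Bn ν, hGB, iSup_le fun ν => inf_le_right.trans inf_le_left, ?_, fun ν => ?_⟩
  · rw [eq_bot_iff]
    rintro x ⟨hx, hx'⟩
    obtain ⟨s, hs⟩ := exists_sum_pr x
    rw [← hs]
    refine sum_mem fun ν _ => ?_
    have h1 : pr K d ν x ∈ Q ν := (pr_iSup hBn hx ν).1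
    have h2 : pr K d ν x ∈ I * V K d ⊓ homComponent K d ν := ⟨hGV ν x hx', pr_mem _ _⟩
    exact (hQ ν).disjoint.le_bot ⟨h2, h1⟩
  · rw [hBh, ← sup_inf_assoc_of_le, (hQ ν).sup_eq_top, top_inf_eq]
    exact inf_le_inf_right _ hIV

theorem main_hilb {I J : Submodule K (FreeAlgebra K (Fin d))} (hI : ∀ x ∈ I, ∀ y, x * y ∈ I)
    (hJ : ∀ x ∈ J, ∀ y, y * x ∈ J) (hGI : Gr I) (hGJ : Gr J) :
    hilbertSeriesOf K d (I * J) = (1 - ∑ i : Fin d, MvPowerSeries.X i) *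
      (hilbertSeriesOf K d I * hilbertSeriesOf K d J) := by
  obtain ⟨B, hGB, hBI, hdis, hsup⟩ := exists_B hI hGI
  have h1 : hilbertSeriesOf K d I =
      hilbertSeriesOf K d (I * V K d) + hilbertSeriesOf K d B := by
    ext ν
    show (finrank K ↥(I ⊓ homComponent K d ν) : ℚ) = finrank K ↥((I * V K d) ⊓ homComponent K d ν)
      + finrank K ↥(B ⊓ homComponent K d ν)
    have := Submodule.finrank_sup_add_finrank_inf_eq ((I * V K d) ⊓ homComponent K d ν)
      (B ⊓ homComponent K d ν)
    have hb : (I * V K d ⊓ homComponent K d ν) ⊓ (B ⊓ homComponent K d ν) = ⊥ := by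
      rw [eq_bot_iff, ← hdis]
      exact le_inf (inf_le_right.trans inf_le_left) (inf_le_left.trans inf_le_left)
    rw [hsup, hb, finrank_bot, add_zero] at this
    exact_mod_cast this
  have h2 : hilbertSeriesOf K d (I * V K d) =
      hilbertSeriesOf K d I * ∑ i : Fin d, MvPowerSeries.X i := by
    rw [hilb_mul hGI gr_V (disj_V I), hilb_V]
  have h3 : hilbertSeriesOf K d (B * J) = hilbertSeriesOf K d B * hilbertSeriesOf K d J :=
    hilb_mul hGB hGJ (disj_B hI hBI hdis J)
  have h4 : ∀ n : ℕ, ∀ ν : Fin d →₀ ℕ, ν.degree = n → I ⊓ homComponent K d ν ≤ B * ⊤ := by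
    intro n
    induction n using Nat.strong_induction_on with
    | _ n ih =>
      intro ν hν
      rw [← hsup]
      refine sup_le ?_ ?_
      · rw [mul_inf_hom hGI gr_V]
        refine iSup_le fun ⟨⟨μ, l⟩, hp⟩ => ?_
        rw [Finset.HasAntidiagonal.mem_antidiagonal] at hp
        dsimp only at hp ⊢
        by_cases hl : l = 0
        · have : V K d ⊓ homComponent K d l = ⊥ := by
            rw [V_inf, hl]
            simp
          rw [this, Submodule.mul_bot]
          exact bot_le
        · have hlt : μ.degree < n := by
            have : l.degree ≠ 0 := by simpa [Finsupp.degree_eq_zero_iff] using hl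
            rw [← hν, ← hp, map_add]
            omega
          calc _ ≤ (B * ⊤) * ⊤ := mul_le_mul' (ih _ hlt μ rfl) le_top
            _ ≤ B * ⊤ := by
              rw [mul_assoc]
              exact mul_le_mul' le_rfl le_top
      · intro x hx
        rw [← mul_one x]
        exact Submodule.mul_mem_mul hx.1 trivial
  have h5 : I ≤ B * ⊤ := by
    intro x hx
    obtain ⟨s, hs⟩ := exists_sum_pr x
    rw [← hs]
    exact sum_mem fun ν _ => h4 _ ν rfl ⟨hGI ν x hx, pr_mem _ _⟩
  have h6 : I * J = B * J := by
    refine le_antisymm ?_ (mul_le_mul' hBI le_rfl)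
    calc I * J ≤ (B * ⊤) * J := mul_le_mul' h5 le_rfl
      _ = B * (⊤ * J) := mul_assoc _ _ _
      _ ≤ B * J := mul_le_mul' le_rfl (Submodule.mul_le.2 fun y _ x hx => hJ x hx y)
  rw [h6, h3]
  have h7 : hilbertSeriesOf K d B = hilbertSeriesOf K d I -
      hilbertSeriesOf K d I * ∑ i : Fin d, MvPowerSeries.X i := by
    rw [← h2, h1]
    ring
  rw [h7]
  ring

section T

variable {R : Type*} [Ring R] [Algebra K R]

theorem mem_T (f : FreeAlgebra K ℕ) : f ∈ Tideal K R ↔ ∀ φ : FreeAlgebra K ℕ →ₐ[K] R, φ f = 0 := by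
  simp [Tideal]

theorem mem_TD (f : FreeAlgebra K (Fin d)) :
    f ∈ TidealD K d R ↔ ∀ φ : FreeAlgebra K (Fin d) →ₐ[K] R, φ f = 0 := by
  unfold TidealD
  rw [Submodule.mem_comap, mem_T]
  constructor
  · intro h φ
    let ψ : FreeAlgebra K ℕ →ₐ[K] R := FreeAlgebra.lift K fun n =>
      if hn : n < d then φ (FreeAlgebra.ι K ⟨n, hn⟩) else 0
    have : ψ.comp (embedFree K d) = φ := by
      ext i
      simp [ψ, embedFree]
    rw [← this]
    exact h ψ
  · intro h ψ
    exact h (ψ.comp (embedFree K d))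

/-- retraction onto the free algebra of rank `d` -/
noncomputable def retr (K : Type*) [Field K] (d : ℕ) :
    FreeAlgebra K ℕ →ₐ[K] FreeAlgebra K (Fin d) :=
  FreeAlgebra.lift K fun n => if hn : n < d then FreeAlgebra.ι K ⟨n, hn⟩ else 0

theorem retr_embed (f : FreeAlgebra K (Fin d)) : retr K d (embedFree K d f) = f := by
  have : (retr K d).comp (embedFree K d) = AlgHom.id K _ := by
    ext i
    simp [retr, embedFree]
  exact DFunLike.congr_fun this f

theorem retr_mem {f : FreeAlgebra K ℕ} (hf : f ∈ Tideal K R) : retr K d f ∈ TidealD K d R := by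
  rw [mem_TD]
  intro φ
  exact (mem_T f).1 hf (φ.comp (retr K d))

theorem gr_T : Gr (TidealD K d R) := by
  intro ν f hf
  by_contra hne
  obtain ⟨l, hl, hle⟩ := Submodule.exists_le_ker_of_notMem hne
  let P : FreeAlgebra K (Fin d) →ₗ[K] MvPolynomial (Fin d) K :=
    (e K d).constr K fun w => MvPolynomial.monomial (dg w) (l (e K d w))
  have hP : ∀ w, P (e K d w) = MvPolynomial.monomial (dg w) (l (e K d w)) := fun w => by
    simp only [P, Basis.constr_basis]
  have hc : (MvPolynomial.lcoeff K ν) ∘ₗ P = l ∘ₗ pr K d ν := by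
    refine (e K d).ext fun w => ?_
    simp only [LinearMap.comp_apply, hP, pr_e, MvPolynomial.lcoeff_apply,
      MvPolynomial.coeff_monomial]
    split_ifs <;> simp
  have hz : P f = 0 := by
    apply MvPolynomial.funext
    intro s
    rw [map_zero]
    let σ : FreeAlgebra K (Fin d) →ₐ[K] FreeAlgebra K (Fin d) :=
      FreeAlgebra.lift K fun i => s i • FreeAlgebra.ι K i
    have hσ : ∀ w, σ (e K d w) = (dg w).prod (fun i n => s i ^ n) • e K d w := by
      intro w
      induction w using FreeMonoid.inductionOn' with
      | one => simp [e_one, dg_one]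
      | of_mul i w ih =>
        rw [e_mul, map_mul, ih, dg_mul, Finsupp.prod_add_index' (by simp) (by simp [pow_add]),
          dg_of, e_of, Finsupp.prod_single_index (by simp)]
        simp [σ, smul_smul, mul_comm]
    have he : (MvPolynomial.aeval s).toLinearMap ∘ₗ P = l ∘ₗ σ.toLinearMap := by
      refine (e K d).ext fun w => ?_
      simp only [LinearMap.comp_apply, hP, AlgHom.toLinearMap_apply, hσ]
      simp [MvPolynomial.aeval_monomial, mul_comm]
    have h1 := LinearMap.congr_fun he f
    simp only [LinearMap.comp_apply, AlgHom.toLinearMap_apply] at h1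
    rw [MvPolynomial.aeval_eq_eval] at h1
    have h2 : σ f ∈ TidealD K d R := by
      rw [mem_TD] at hf ⊢
      intro φ
      exact hf (φ.comp σ)
    exact h1.trans (hle h2)
  have := LinearMap.congr_fun hc f
  simp only [LinearMap.comp_apply, hz, map_zero] at this
  exact hl this.symm

end T

theorem TD_mul {R R₁ R₂ : Type*} [Ring R] [Algebra K R] [Ring R₁] [Algebra K R₁]
    [Ring R₂] [Algebra K R₂] (hT : Tideal K R = Tideal K R₁ * Tideal K R₂) :
    TidealD K d R = TidealD K d R₁ * TidealD K d R₂ := by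
  apply le_antisymm
  · intro f hf
    have h : embedFree K d f ∈ Tideal K R₁ * Tideal K R₂ := hT ▸ hf
    have h2 : Tideal K R₁ * Tideal K R₂ ≤
        (TidealD K d R₁ * TidealD K d R₂).comap (retr K d).toLinearMap := by
      rw [Submodule.mul_le]
      intro a ha b hb
      rw [Submodule.mem_comap, AlgHom.toLinearMap_apply, map_mul]
      exact Submodule.mul_mem_mul (retr_mem ha) (retr_mem hb)
    have h3 := h2 h
    rw [Submodule.mem_comap, AlgHom.toLinearMap_apply, retr_embed] at h3
    exact h3
  · rw [Submodule.mul_le]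
    intro a ha b hb
    show embedFree K d (a * b) ∈ Tideal K R
    rw [hT, map_mul]
    exact Submodule.mul_mem_mul ha hb

end Formanek


/-- Formanek. If `T(R) = T(R₁)·T(R₂)`, then for every `d ≥ 1`,
`(1 - (t₁+⋯+t_d))⁻¹ · H(K⟨X_d⟩ ∩ T(R)) = H(K⟨X_d⟩ ∩ T(R₁)) · H(K⟨X_d⟩ ∩ T(R₂))`. -/
theorem stmt0 (K : Type*) [Field K] [CharZero K]
    (R R₁ R₂ : Type*) [Ring R] [Algebra K R] [Ring R₁] [Algebra K R₁] [Ring R₂] [Algebra K R₂]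
    (hT : Tideal K R = Tideal K R₁ * Tideal K R₂)
    (d : ℕ) (hd : 1 ≤ d) :
    (1 - ∑ i : Fin d, (MvPowerSeries.X i : MvPowerSeries (Fin d) ℚ))⁻¹ *
        hilbertSeriesOf K d (TidealD K d R) =
      hilbertSeriesOf K d (TidealD K d R₁) * hilbertSeriesOf K d (TidealD K d R₂) := by
  rw [Formanek.TD_mul hT, Formanek.main_hilb (fun x hx y => ?_) (fun x hx y => ?_)
    Formanek.gr_T Formanek.gr_T, ← mul_assoc, MvPowerSeries.inv_mul_cancel, one_mul]
  · simp
  · rw [Formanek.mem_TD] at hx ⊢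
    intro φ
    rw [map_mul, hx, zero_mul]
  · rw [Formanek.mem_TD] at hx ⊢
    intro φ
    rw [map_mul, hx, mul_zero]
end

section
/- Let R, R₁, R₂ be unital associative K-algebras such that T(R) = T(R₁)·T(R₂). Then for every d ≥ 1 the Hilbert series of the relatively free algebras satisfy H(F_d(R)) = H(F_d(R₁)) + H(F_d(R₂)) + (t₁+⋯+t_d − 1)·H(F_d(R₁))·H(F_d(R₂)) as formal power series in t₁,…,t_d. -/
open scoped BigOperators
open MvPowerSeries

namespace Aux
universe v
set_option linter.unusedSectionVars false

noncomputable section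
variable (K : Type*) [Field K] (d : ℕ)

/-- The monomial attached to a word. -/
def wd (w : List (Fin d)) : FreeAlgebra K (Fin d) := (w.map (FreeAlgebra.ι K)).prod

/-- The multidegree of a word. -/
def dg {d : ℕ} (w : List (Fin d)) : Fin d →₀ ℕ := Multiset.toFinsupp (w : Multiset (Fin d))

/-- The monomial basis. -/
def Bw : Module.Basis (List (Fin d)) K (FreeAlgebra K (Fin d)) :=
  (FreeAlgebra.basisFreeMonoid K (Fin d)).reindex FreeMonoid.toList

theorem Bw_apply (w : List (Fin d)) : Bw K d w = wd K d w := by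
  simp only [Bw, FreeAlgebra.basisFreeMonoid, wd, Module.Basis.reindex_apply, Module.Basis.map_apply]
  rw [LinearEquiv.symm_apply_eq]
  simp only [LinearEquiv.trans_apply, AlgEquiv.toLinearEquiv_apply, map_list_prod, List.map_map]
  have : ∀ w : List (Fin d), (List.map (⇑(FreeAlgebra.equivMonoidAlgebraFreeMonoid (R := K)) ∘ FreeAlgebra.ι K) w).prod
      = MonoidAlgebra.single (FreeMonoid.ofList w) 1 := by
    intro w
    induction w with
    | nil => rfl
    | cons a w ih =>
      rw [List.map_cons, List.prod_cons, ih]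
      simp [FreeAlgebra.equivMonoidAlgebraFreeMonoid, MonoidAlgebra.single_mul_single]
  rw [this]
  ext
  simp

variable {d} in
theorem dg_apply (w : List (Fin d)) (i : Fin d) : dg w i = w.count i := by
  simp [dg]

variable {d} in
theorem dg_append (w v : List (Fin d)) : dg (w ++ v) = dg w + dg v := by
  ext i; simp [dg_apply]

variable {d} in
theorem dg_singleton (i : Fin d) : dg [i] = Finsupp.single i 1 := by
  simp [dg]

theorem wd_append (w v : List (Fin d)) : wd K d (w ++ v) = wd K d w * wd K d v := by
  simp [wd]

theorem wd_singleton (i : Fin d) : wd K d [i] = FreeAlgebra.ι K i := by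
  simp [wd]

theorem wd_nil : wd K d [] = 1 := by
  simp [wd]

theorem span_wd : Submodule.span K (Set.range (wd K d)) = ⊤ := by
  rw [← (Bw K d).span_eq]
  congr 2
  ext w
  rw [Bw_apply]

variable {K d} in
/-- Linear induction on monomials. -/
theorem wd_induction {p : FreeAlgebra K (Fin d) → Prop} (h0 : p 0)
    (hadd : ∀ x y, p x → p y → p (x + y)) (hsmul : ∀ (c : K) x, p x → p (c • x))
    (hw : ∀ w, p (wd K d w)) (x) : p x := by
  have hx : x ∈ Submodule.span K (Set.range (wd K d)) := by rw [span_wd]; trivial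
  induction hx using Submodule.span_induction with
  | mem x h => obtain ⟨w, rfl⟩ := h; exact hw w
  | zero => exact h0
  | add x y _ _ hx hy => exact hadd x y hx hy
  | smul c x _ hx => exact hsmul c x hx

theorem homComponent_eq [CharZero K] (ν : Fin d →₀ ℕ) :
    homComponent K d ν = Submodule.span K (wd K d '' {w | dg w = ν}) := by
  unfold homComponent
  congr 1
  ext x
  simp only [Set.mem_ofPred_eq, Set.mem_image, wd]
  constructor
  · rintro ⟨w, h, rfl⟩
    exact ⟨w, by ext i; rw [dg_apply, h], rfl⟩
  · rintro ⟨w, rfl, rfl⟩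
    exact ⟨w, fun i => (dg_apply w i).symm, rfl⟩

/-- Projection to the multihomogeneous component. -/
def comp (ν : Fin d →₀ ℕ) : FreeAlgebra K (Fin d) →ₗ[K] FreeAlgebra K (Fin d) :=
  (Bw K d).constr K (fun w => if dg w = ν then wd K d w else 0)

theorem comp_wd (ν) (w) : comp K d ν (wd K d w) = if dg w = ν then wd K d w else 0 := by
  rw [← Bw_apply, comp, Module.Basis.constr_basis, Bw_apply]

/-- Right division by a generator. -/
def rdiv (i : Fin d) : FreeAlgebra K (Fin d) →ₗ[K] FreeAlgebra K (Fin d) :=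
  (Bw K d).constr K (fun w => if w.getLast? = some i then wd K d w.dropLast else 0)

theorem rdiv_wd (i) (w) : rdiv K d i (wd K d w) =
    if w.getLast? = some i then wd K d w.dropLast else 0 := by
  rw [← Bw_apply, rdiv, Module.Basis.constr_basis]

/-- The constant term. -/
def eps : FreeAlgebra K (Fin d) →ₗ[K] K :=
  (Bw K d).constr K (fun w => if w = [] then 1 else 0)

theorem eps_wd (w) : eps K d (wd K d w) = if w = [] then 1 else 0 := by
  rw [← Bw_apply, eps, Module.Basis.constr_basis]

theorem rdiv_mul_ι (i j : Fin d) (f : FreeAlgebra K (Fin d)) :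
    rdiv K d i (f * FreeAlgebra.ι K j) = if j = i then f else 0 := by
  induction f using wd_induction with
  | h0 => simp
  | hadd x y hx hy => rw [add_mul, map_add, hx, hy]; split_ifs <;> simp
  | hsmul c x hx => rw [smul_mul_assoc, map_smul, hx]; split_ifs <;> simp
  | hw w => rw [← wd_singleton, ← wd_append, rdiv_wd]; simp

theorem decomp (f : FreeAlgebra K (Fin d)) :
    f = eps K d f • 1 + ∑ i, rdiv K d i f * FreeAlgebra.ι K i := by
  induction f using wd_induction with
  | h0 => simp
  | hadd x y hx hy =>
    simp only [map_add, add_mul, add_smul, Finset.sum_add_distrib]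
    conv_lhs => rw [hx, hy]
    abel
  | hsmul c x hx =>
    simp only [map_smul, smul_mul_assoc, ← Finset.smul_sum, smul_assoc, ← smul_add]
    rw [← hx]
  | hw w =>
    rcases List.eq_nil_or_concat w with rfl | ⟨v, j, rfl⟩
    · simp only [eps_wd, rdiv_wd]
      simp [wd_nil]
    · simp only [eps_wd, rdiv_wd]
      simp [wd_append, wd_singleton]

theorem repr_wd (v w : List (Fin d)) : (Bw K d).repr (wd K d v) w = if v = w then 1 else 0 := by
  rw [← Bw_apply, Module.Basis.repr_self, Finsupp.single_apply]

theorem repr_nil (f : FreeAlgebra K (Fin d)) : (Bw K d).repr f [] = eps K d f := by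
  induction f using wd_induction with
  | h0 => simp
  | hadd x y hx hy => simp [hx, hy]
  | hsmul c x hx => simp [hx]
  | hw w => rw [repr_wd, eps_wd]

theorem repr_rdiv (f : FreeAlgebra K (Fin d)) (w i) :
    (Bw K d).repr f (w ++ [i]) = (Bw K d).repr (rdiv K d i f) w := by
  induction f using wd_induction with
  | h0 => simp
  | hadd x y hx hy => simp [hx, hy]
  | hsmul c x hx => simp [hx]
  | hw v =>
    rw [repr_wd, rdiv_wd]
    rcases List.eq_nil_or_concat v with rfl | ⟨v, j, rfl⟩
    · simp
    · by_cases h : j = i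
      · subst h; simp [repr_wd]
      · simp [h]

/-- The right span `∑ I x_i`. -/
def PI (I : Submodule K (FreeAlgebra K (Fin d))) : Submodule K (FreeAlgebra K (Fin d)) :=
  ⨆ i, I.map (LinearMap.mulRight K (FreeAlgebra.ι K i))

variable {K d}

theorem mem_PI {I : Submodule K (FreeAlgebra K (Fin d))} {f} (hf : f ∈ I) (i) :
    f * FreeAlgebra.ι K i ∈ PI K d I :=
  (le_iSup (fun i => I.map (LinearMap.mulRight K (FreeAlgebra.ι K i))) i) ⟨f, hf, rfl⟩

/-- Right independence. -/
theorem right_indep {I : Submodule K (FreeAlgebra K (Fin d))} (hI : ∀ f ∈ I, ∀ g, f * g ∈ I)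
    {κ : Type*} (u : κ → FreeAlgebra K (Fin d)) (hu : ∀ k, u k ∈ I)
    (hli : LinearIndependent K ((PI K d I).mkQ ∘ u)) (s : Finset κ)
    (w : List (Fin d)) :
    ∀ f : κ → FreeAlgebra K (Fin d), ∑ k ∈ s, u k * f k = 0 →
      ∀ k ∈ s, (Bw K d).repr (f k) w = 0 := by
  have key : ∀ f : κ → FreeAlgebra K (Fin d), ∑ k ∈ s, u k * f k = 0 →
      ∀ k ∈ s, eps K d (f k) = 0 := by
    intro f hf
    rw [linearIndependent_iff'] at hli
    apply hli
    have h1 : ∑ k ∈ s, eps K d (f k) • u k = - ∑ k ∈ s, ∑ i, (u k * rdiv K d i (f k)) * FreeAlgebra.ι K i := by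
      rw [eq_neg_iff_add_eq_zero, ← Finset.sum_add_distrib, ← hf]
      refine Finset.sum_congr rfl fun k _ => ?_
      conv_rhs => rw [decomp K d (f k)]
      rw [mul_add, Finset.mul_sum, mul_smul_comm, mul_one]
      simp only [mul_assoc]
    have h2 : ∑ k ∈ s, eps K d (f k) • u k ∈ PI K d I := by
      rw [h1]
      exact neg_mem (sum_mem fun k _ => sum_mem fun i _ => mem_PI (hI _ (hu k) _) i)
    simp only [Function.comp_apply, ← map_smul, ← map_sum]
    exact (Submodule.Quotient.mk_eq_zero _).2 h2
  induction w using List.reverseRecOn with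
  | nil =>
    intro f hf k hk
    rw [repr_nil]
    exact key f hf k hk
  | append_singleton w i ih =>
    intro f hf
    have h0 := key f hf
    have : ∑ k ∈ s, u k * rdiv K d i (f k) = 0 := by
      have := congrArg (rdiv K d i) hf
      rw [map_zero] at this
      rw [← this, map_sum]
      refine Finset.sum_congr rfl fun k hk => ?_
      conv_rhs => rw [decomp K d (f k), h0 k hk, zero_smul, zero_add, Finset.mul_sum]
      simp only [← mul_assoc, map_sum, rdiv_mul_ι]
      simp
    intro k hk
    rw [repr_rdiv]
    exact ih _ this k hk

theorem prod_indep {I : Submodule K (FreeAlgebra K (Fin d))} (hI : ∀ f ∈ I, ∀ g, f * g ∈ I)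
    {κ l : Type*} (u : κ → FreeAlgebra K (Fin d)) (hu : ∀ k, u k ∈ I)
    (hli : LinearIndependent K ((PI K d I).mkQ ∘ u))
    (v : l → FreeAlgebra K (Fin d)) (hv : LinearIndependent K v) :
    LinearIndependent K (fun p : κ × l => u p.1 * v p.2) := by
  classical
  rw [linearIndependent_iff'']
  intro s g hg hs
  have h1 : ∑ p ∈ s.image Prod.fst ×ˢ s.image Prod.snd, g p • (u p.1 * v p.2) = 0 := by
    rw [← hs]
    symm
    apply Finset.sum_subset
    · intro p hp
      simp only [Finset.mem_product, Finset.mem_image]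
      exact ⟨⟨p, hp, rfl⟩, ⟨p, hp, rfl⟩⟩
    · intro p _ hp
      rw [hg p hp, zero_smul]
  rw [Finset.sum_product] at h1
  have h2 : ∑ k ∈ s.image Prod.fst, u k * ∑ j ∈ s.image Prod.snd, g (k, j) • v j = 0 := by
    rw [← h1]
    refine Finset.sum_congr rfl fun k _ => ?_
    rw [Finset.mul_sum]
    simp only [mul_smul_comm]
  rintro ⟨k, j⟩
  by_cases hp : (k, j) ∈ s
  · have h3 : ∑ j ∈ s.image Prod.snd, g (k, j) • v j = 0 := by
      apply (Bw K d).repr.injective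
      ext w
      rw [map_zero]
      exact right_indep hI u hu hli _ w _ h2 k (Finset.mem_image_of_mem Prod.fst hp)
    exact (linearIndependent_iff'.1 hv) _ _ h3 j (Finset.mem_image_of_mem Prod.snd hp)
  · exact hg _ hp


/-! ### Generating functions -/

/-- Generating function of a graded set. -/
def gf {ι : Type*} (a : ι → Fin d →₀ ℕ) : MvPowerSeries (Fin d) ℚ :=
  fun ν => (Nat.card {k // a k = ν} : ℚ)

theorem coeff_gf {ι : Type*} (a : ι → Fin d →₀ ℕ) (ν) :
    MvPowerSeries.coeff ν (gf a) = (Nat.card {k // a k = ν} : ℚ) := rfl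

theorem gf_equiv {ι ι' : Type*} (e : ι ≃ ι') (a : ι → Fin d →₀ ℕ) (b : ι' → Fin d →₀ ℕ)
    (h : ∀ k, b (e k) = a k) : gf a = gf b := by
  ext ν
  rw [coeff_gf, coeff_gf]
  congr 1
  exact Nat.card_congr (e.subtypeEquiv fun k => by rw [h])

theorem gf_sum {ι ι' : Type*} (a : ι → Fin d →₀ ℕ) (b : ι' → Fin d →₀ ℕ)
    (ha : ∀ ν, Finite {k // a k = ν}) (hb : ∀ ν, Finite {k // b k = ν}) :
    gf (Sum.elim a b) = gf a + gf b := by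
  ext ν
  have := ha ν
  have := hb ν
  rw [map_add, coeff_gf, coeff_gf, coeff_gf, ← Nat.cast_add, ← Nat.card_sum]
  congr 1
  exact Nat.card_congr Equiv.subtypeSum

theorem gf_prod {ι ι' : Type*} (a : ι → Fin d →₀ ℕ) (b : ι' → Fin d →₀ ℕ)
    (ha : ∀ ν, Finite {k // a k = ν}) (hb : ∀ ν, Finite {k // b k = ν}) :
    gf (fun p : ι × ι' => a p.1 + b p.2) = gf a * gf b := by
  classical
  ext ν
  rw [MvPowerSeries.coeff_mul]
  simp only [coeff_gf]
  let e : {p : ι × ι' // a p.1 + b p.2 = ν} ≃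
      Σ q : {q // q ∈ Finset.HasAntidiagonal.antidiagonal ν}, {k // a k = q.1.1} × {l // b l = q.1.2} :=
    { toFun := fun p => ⟨⟨(a p.1.1, b p.1.2), by simpa using p.2⟩, ⟨p.1.1, rfl⟩, ⟨p.1.2, rfl⟩⟩
      invFun := fun q => ⟨(q.2.1.1, q.2.2.1), by
        rw [q.2.1.2, q.2.2.2]; exact Finset.HasAntidiagonal.mem_antidiagonal.1 q.1.2⟩
      left_inv := fun p => rfl
      right_inv := by
        rintro ⟨⟨⟨x, y⟩, h⟩, ⟨k, hk⟩, ⟨l, hl⟩⟩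
        dsimp only at hk hl
        subst hk hl
        rfl }
  rw [Nat.card_congr e, Nat.card_sigma]
  simp only [Nat.card_prod]
  push_cast
  exact Finset.sum_coe_sort (Finset.HasAntidiagonal.antidiagonal ν)
    (fun q => (Nat.card {k // a k = q.1} : ℚ) * (Nat.card {l // b l = q.2} : ℚ))

theorem gf_X : gf (fun i : Fin d => Finsupp.single i 1) =
    ∑ i : Fin d, (MvPowerSeries.X i : MvPowerSeries (Fin d) ℚ) := by
  classical
  ext ν
  rw [coeff_gf, map_sum]
  simp only [MvPowerSeries.coeff_X]
  rw [Finset.sum_boole, Nat.card_eq_fintype_card, Fintype.card_subtype]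
  congr 3
  ext i
  exact eq_comm

theorem gf_unit : gf (fun _ : Unit => (0 : Fin d →₀ ℕ)) = 1 := by
  classical
  ext ν
  rw [coeff_gf, MvPowerSeries.coeff_one]
  split_ifs with h
  · subst h
    simp
  · have : IsEmpty {k : Unit // (0 : Fin d →₀ ℕ) = ν} := ⟨fun x => h x.2.symm⟩
    simp

theorem finite_dg (ν : Fin d →₀ ℕ) : Finite {w : List (Fin d) // dg w = ν} := by
  have : Set.Finite {w : List (Fin d) | dg w = ν} := by
    refine (List.finite_length_eq (Fin d) (ν.sum fun _ n => n)).subset ?_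
    rintro w rfl
    simp only [Set.mem_ofPred_eq]
    have := Multiset.toFinsupp_sum_eq (w : Multiset (Fin d))
    exact this.symm
  exact this

/-- Lists are empty or have a head and a tail. -/
def listEquiv (α : Type*) : Unit ⊕ (α × List α) ≃ List α where
  toFun := Sum.elim (fun _ => []) (fun p => p.1 :: p.2)
  invFun := fun l => match l with
    | [] => Sum.inl ()
    | a :: l => Sum.inr (a, l)
  left_inv := by rintro (_ | ⟨a, l⟩) <;> rfl
  right_inv := by rintro (_ | ⟨a, l⟩) <;> rfl

theorem gf_words : gf (dg (d := d)) =
    1 + (∑ i : Fin d, (MvPowerSeries.X i : MvPowerSeries (Fin d) ℚ)) * gf (dg (d := d)) := by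
  have hX : ∀ ν, Finite {i : Fin d // Finsupp.single i 1 = ν} := fun ν => inferInstance
  have hP : ∀ ν, Finite {p : Fin d × List (Fin d) // Finsupp.single p.1 1 + dg p.2 = ν} := by
    intro ν
    have := finite_dg ν
    refine Finite.of_injective
      (β := {w : List (Fin d) // dg w = ν}) (fun p => ⟨p.1.1 :: p.1.2, ?_⟩) ?_
    · exact ((dg_append [p.1.1] p.1.2).trans (by rw [dg_singleton])).trans p.2
    · rintro ⟨⟨a, b⟩, h⟩ ⟨⟨a', b'⟩, h'⟩ hh
      simpa using hh
  rw [← gf_X, ← gf_unit, ← gf_prod _ _ hX finite_dg, ← gf_sum _ _ (fun ν => inferInstance) hP]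
  symm
  apply gf_equiv (listEquiv (Fin d))
  rintro (_ | ⟨a, l⟩)
  · ext; simp [listEquiv, dg]
  · simp only [listEquiv, Equiv.coe_fn_mk, Sum.elim_inr]
    rw [← List.singleton_append, dg_append, dg_singleton]

/-! ### Graded structure -/

section graded
variable [CharZero K]

theorem wd_mem (w : List (Fin d)) : wd K d w ∈ homComponent K d (dg w) := by
  rw [homComponent_eq]
  exact Submodule.subset_span ⟨w, rfl, rfl⟩

theorem comp_mem (ν) (x : FreeAlgebra K (Fin d)) : comp K d ν x ∈ homComponent K d ν := by
  induction x using wd_induction with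
  | h0 => simp
  | hadd x y hx hy => rw [map_add]; exact add_mem hx hy
  | hsmul c x hx => rw [map_smul]; exact Submodule.smul_mem _ _ hx
  | hw w =>
    rw [comp_wd]
    split_ifs with h
    · subst h; exact wd_mem w
    · simp

theorem comp_of_mem {μ} (ν) {x : FreeAlgebra K (Fin d)} (hx : x ∈ homComponent K d μ) :
    comp K d ν x = if μ = ν then x else 0 := by
  rw [homComponent_eq] at hx
  induction hx using Submodule.span_induction with
  | mem x h => obtain ⟨w, rfl, rfl⟩ := h; rw [comp_wd]
  | zero => simp
  | add x y _ _ hx hy => rw [map_add, hx, hy]; split_ifs <;> simp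
  | smul c x _ hx => rw [map_smul, hx]; split_ifs <;> simp

theorem sum_comp (x : FreeAlgebra K (Fin d)) :
    ∃ s : Finset (Fin d →₀ ℕ), ∑ ν ∈ s, comp K d ν x = x := by
  classical
  obtain ⟨c, rfl⟩ : ∃ c, x = Finsupp.linearCombination K (Bw K d) c :=
    ⟨(Bw K d).repr x, ((Bw K d).linearCombination_repr x).symm⟩
  refine ⟨c.support.image dg, ?_⟩
  rw [Finsupp.linearCombination_apply, Finsupp.sum]
  simp only [map_sum, map_smul]
  rw [Finset.sum_comm]
  refine Finset.sum_congr rfl fun w hw => ?_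
  rw [← Finset.smul_sum, Bw_apply]
  simp only [comp_wd]
  rw [Finset.sum_ite_eq, if_pos (Finset.mem_image_of_mem _ hw)]

theorem mul_mem_hom {μ ν} {x y : FreeAlgebra K (Fin d)} (hx : x ∈ homComponent K d μ)
    (hy : y ∈ homComponent K d ν) : x * y ∈ homComponent K d (μ + ν) := by
  have : x * y ∈ homComponent K d μ * homComponent K d ν := Submodule.mul_mem_mul hx hy
  rw [homComponent_eq, homComponent_eq, Submodule.span_mul_span] at this
  refine (Submodule.span_le.2 ?_) this
  rintro _ ⟨_, ⟨w, rfl, rfl⟩, _, ⟨v, rfl, rfl⟩, rfl⟩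
  change wd K d w * wd K d v ∈ _
  rw [← wd_append, ← dg_append]
  exact wd_mem _

theorem comp_mul_ι (μ) (i : Fin d) (g : FreeAlgebra K (Fin d)) :
    comp K d (μ + Finsupp.single i 1) (g * FreeAlgebra.ι K i) = comp K d μ g * FreeAlgebra.ι K i := by
  induction g using wd_induction with
  | h0 => simp
  | hadd x y hx hy => rw [add_mul, map_add, hx, hy, map_add, add_mul]
  | hsmul c x hx => rw [smul_mul_assoc, map_smul, hx, map_smul, smul_mul_assoc]
  | hw w =>
    rw [← wd_singleton, ← wd_append, comp_wd, comp_wd, dg_append, dg_singleton, wd_append]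
    simp

theorem comp_mul_ι_zero (ν) (i : Fin d) (hν : ν i = 0) (g : FreeAlgebra K (Fin d)) :
    comp K d ν (g * FreeAlgebra.ι K i) = 0 := by
  induction g using wd_induction with
  | h0 => simp
  | hadd x y hx hy => rw [add_mul, map_add, hx, hy, add_zero]
  | hsmul c x hx => rw [smul_mul_assoc, map_smul, hx, smul_zero]
  | hw w =>
    rw [← wd_singleton, ← wd_append, comp_wd, dg_append, dg_singleton, if_neg]
    rintro rfl
    simp at hν

/-- Homogeneous subspaces. -/
def Homog (W : Submodule K (FreeAlgebra K (Fin d))) : Prop := ∀ x ∈ W, ∀ ν, comp K d ν x ∈ W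

instance finite_hom (ν) : Module.Finite K (homComponent K d ν) := by
  rw [homComponent_eq]
  apply Module.Finite.span_of_finite
  exact Set.Finite.image _ (finite_dg ν)

theorem exists_fam {K : Type v} [Field K] [CharZero K]
    (W P : Submodule K (FreeAlgebra K (Fin d))) (hW : Homog W) :
    ∃ (κ : Type v) (u : κ → FreeAlgebra K (Fin d)) (a : κ → Fin d →₀ ℕ),
      (∀ k, u k ∈ W) ∧ (∀ k, u k ∈ homComponent K d (a k)) ∧
      LinearIndependent K (P.mkQ ∘ u) ∧ W ≤ P ⊔ Submodule.span K (Set.range u) := by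
  let ι := {p : (Fin d →₀ ℕ) × FreeAlgebra K (Fin d) // p.2 ∈ W ∧ p.2 ∈ homComponent K d p.1}
  obtain ⟨κ, f, -, hs, hl⟩ := exists_linearIndependent' (K := K) (fun p : ι => P.mkQ p.1.2)
  refine ⟨κ, fun k => (f k).1.2, fun k => (f k).1.1, fun k => (f k).2.1, fun k => (f k).2.2, hl, ?_⟩
  rw [← Submodule.comap_map_mkQ, Submodule.map_span, ← Set.range_comp]
  intro x hx
  rw [Submodule.mem_comap]
  change _ ∈ Submodule.span K (Set.range ((fun p : ι => P.mkQ p.1.2) ∘ f))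
  rw [hs]
  obtain ⟨s, hs⟩ := sum_comp x
  rw [← hs, map_sum]
  refine sum_mem fun ν _ => Submodule.subset_span ⟨⟨(ν, comp K d ν x), hW x hx ν, comp_mem ν x⟩, rfl⟩

theorem finite_fiber {κ : Type*} (u : κ → FreeAlgebra K (Fin d)) (a : κ → Fin d →₀ ℕ)
    (hu : LinearIndependent K u) (ha : ∀ k, u k ∈ homComponent K d (a k)) (ν) :
    Finite {k // a k = ν} := by
  have h : LinearIndependent K
      (fun k : {k // a k = ν} => (⟨u k.1, by have := ha k.1; rwa [k.2] at this⟩ : homComponent K d ν)) := by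
    apply LinearIndependent.of_comp (homComponent K d ν).subtype
    exact hu.comp (Subtype.val) Subtype.val_injective
  exact h.finite

theorem hilb_of_basis {κ : Type*} (u : κ → FreeAlgebra K (Fin d)) (a : κ → Fin d →₀ ℕ)
    (hu : LinearIndependent K u) (ha : ∀ k, u k ∈ homComponent K d (a k))
    {W : Submodule K (FreeAlgebra K (Fin d))} (hW : Submodule.span K (Set.range u) = W) :
    hilbertSeriesOf K d W = gf a := by
  ext ν
  change (Module.finrank K ↥(W ⊓ homComponent K d ν) : ℚ) = _
  rw [coeff_gf]
  congr 1
  have hli : LinearIndependent K (fun k : {k // a k = ν} => u k.1) :=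
    hu.comp (Subtype.val) Subtype.val_injective
  have hsp : Submodule.span K (Set.range (fun k : {k // a k = ν} => u k.1)) =
      W ⊓ homComponent K d ν := by
    apply le_antisymm
    · rw [Submodule.span_le]
      rintro _ ⟨⟨k, rfl⟩, rfl⟩
      exact ⟨hW ▸ Submodule.subset_span ⟨k, rfl⟩, ha k⟩
    · rintro x ⟨hx, hx'⟩
      have h1 : comp K d ν x = x := by rw [comp_of_mem ν hx', if_pos rfl]
      rw [← h1]
      rw [← hW] at hx
      have h2 : comp K d ν x ∈ (Submodule.span K (Set.range u)).map (comp K d ν) := ⟨x, hx, rfl⟩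
      rw [Submodule.map_span] at h2
      refine (Submodule.span_le.2 ?_) h2
      rintro _ ⟨_, ⟨k, rfl⟩, rfl⟩
      rw [comp_of_mem ν (ha k)]
      split_ifs with h
      · exact Submodule.subset_span ⟨⟨k, h⟩, rfl⟩
      · exact zero_mem _
  rw [← hsp]
  exact Module.finrank_eq_nat_card_basis (Module.Basis.span hli)

theorem gen {I : Submodule K (FreeAlgebra K (Fin d))}
    {κ : Type*} (u : κ → FreeAlgebra K (Fin d)) (a : κ → Fin d →₀ ℕ)
    (ha : ∀ k, u k ∈ homComponent K d (a k))
    (hs : I ≤ PI K d I ⊔ Submodule.span K (Set.range u)) :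
    I ≤ Submodule.span K (Set.range (fun p : κ × List (Fin d) => u p.1 * wd K d p.2)) := by
  set S := Submodule.span K (Set.range (fun p : κ × List (Fin d) => u p.1 * wd K d p.2)) with hS
  have hmul : ∀ x ∈ S, ∀ i, x * FreeAlgebra.ι K i ∈ S := by
    intro x hx i
    have : S ≤ S.comap (LinearMap.mulRight K (FreeAlgebra.ι K i)) := by
      conv_lhs => rw [hS]
      rw [Submodule.span_le]
      rintro _ ⟨⟨k, w⟩, rfl⟩
      refine Submodule.subset_span ⟨(k, w ++ [i]), ?_⟩
      simp [wd_append, wd_singleton, mul_assoc]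
    exact this hx
  have key : ∀ n : ℕ, ∀ ν : Fin d →₀ ℕ, ν.degree = n → ∀ f ∈ I, comp K d ν f ∈ S := by
    intro n
    induction n using Nat.strong_induction_on with
    | _ n ih =>
      rintro ν rfl f hf
      have h1 : PI K d I ⊔ Submodule.span K (Set.range u) ≤ S.comap (comp K d ν) := by
        refine sup_le (iSup_le fun i => ?_) (Submodule.span_le.2 ?_)
        · rintro _ ⟨g, hg, rfl⟩
          change comp K d ν (g * FreeAlgebra.ι K i) ∈ S
          by_cases h : ν i = 0
          · rw [comp_mul_ι_zero _ _ h]; exact zero_mem _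
          · obtain ⟨μ, rfl⟩ : ∃ μ, ν = μ + Finsupp.single i 1 := by
              refine ⟨ν - Finsupp.single i 1, (tsub_add_cancel_of_le ?_).symm⟩
              rw [Finsupp.single_le_iff]; omega
            rw [comp_mul_ι]
            exact hmul _ (ih _ (by simp) μ rfl g hg) i
        · rintro _ ⟨k, rfl⟩
          change comp K d ν (u k) ∈ S
          rw [comp_of_mem ν (ha k)]
          split_ifs
          · exact Submodule.subset_span ⟨(k, []), by simp [wd_nil]⟩
          · exact zero_mem _
      exact h1 (hs hf)
  intro f hf
  obtain ⟨s, h⟩ := sum_comp f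
  rw [← h]
  exact sum_mem fun ν _ => key _ ν rfl f hf

theorem wd_li : LinearIndependent K (wd K d) := by
  have := (Bw K d).linearIndependent
  rwa [show ⇑(Bw K d) = wd K d from funext (Bw_apply K d)] at this

theorem hilb_top : hilbertSeriesOf K d ⊤ = gf (dg (d := d)) := by
  exact hilb_of_basis (wd K d) dg wd_li wd_mem (span_wd K d)

theorem hilb_mul {I J : Submodule K (FreeAlgebra K (Fin d))} (hI : Homog I) (hJ : Homog J)
    (hIr : ∀ f ∈ I, ∀ g, f * g ∈ I) (hJl : ∀ f ∈ J, ∀ g, g * f ∈ J) :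
    hilbertSeriesOf K d (I * J) * hilbertSeriesOf K d ⊤ =
      hilbertSeriesOf K d I * hilbertSeriesOf K d J := by
  obtain ⟨κ, u, a, huI, ha, hli, hsp⟩ := exists_fam I (PI K d I) hI
  obtain ⟨l, v, b, hvJ, hb, hvli, hvsp⟩ := exists_fam J ⊥ hJ
  have hu : LinearIndependent K u := LinearIndependent.of_comp _ hli
  have hv : LinearIndependent K v := LinearIndependent.of_comp _ hvli
  have hvJ' : Submodule.span K (Set.range v) = J := by
    apply le_antisymm
    · rw [Submodule.span_le]; rintro _ ⟨k, rfl⟩; exact hvJ k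
    · simpa using hvsp
  have hI' : Submodule.span K (Set.range (fun p : κ × List (Fin d) => u p.1 * wd K d p.2)) = I := by
    apply le_antisymm
    · rw [Submodule.span_le]; rintro _ ⟨k, rfl⟩; exact hIr _ (huI _) _
    · exact gen u a ha hsp
  have hIJ : Submodule.span K (Set.range (fun p : κ × l => u p.1 * v p.2)) = I * J := by
    apply le_antisymm
    · rw [Submodule.span_le]; rintro _ ⟨k, rfl⟩; exact Submodule.mul_mem_mul (huI _) (hvJ _)
    · conv_lhs => rw [← hI', ← hvJ', Submodule.span_mul_span]
      rw [Submodule.span_le]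
      rintro _ ⟨_, ⟨⟨k, w⟩, rfl⟩, _, ⟨j, rfl⟩, rfl⟩
      change u k * wd K d w * v j ∈ _
      rw [mul_assoc]
      have h1 : wd K d w * v j ∈ Submodule.span K (Set.range v) := by
        rw [hvJ']; exact hJl _ (hvJ j) _
      have h2 : Submodule.span K (Set.range v) ≤
          (Submodule.span K (Set.range (fun p : κ × l => u p.1 * v p.2))).comap
            (LinearMap.mulLeft K (u k)) := by
        rw [Submodule.span_le]
        rintro _ ⟨j, rfl⟩
        exact Submodule.subset_span ⟨(k, j), rfl⟩
      exact h2 h1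
  have fa := finite_fiber u a hu ha
  have fb := finite_fiber v b hv hb
  rw [hilb_top, hilb_of_basis v b hv hb hvJ',
    hilb_of_basis _ (fun p => a p.1 + dg p.2) (prod_indep hIr u huI hli (wd K d) wd_li)
      (fun p => mul_mem_hom (ha _) (wd_mem _)) hI',
    hilb_of_basis _ (fun p => a p.1 + b p.2) (prod_indep hIr u huI hli v hv)
      (fun p => mul_mem_hom (ha _) (hb _)) hIJ,
    gf_prod a dg fa finite_dg, gf_prod a b fa fb]
  ring

/-! ### T-ideals -/

theorem mem_TidealD {R : Type*} [Ring R] [Algebra K R] (f : FreeAlgebra K (Fin d)) :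
    f ∈ TidealD K d R ↔ ∀ φ : FreeAlgebra K (Fin d) →ₐ[K] R, φ f = 0 := by
  simp only [TidealD, Tideal, Submodule.mem_comap, Submodule.mem_iInf, LinearMap.mem_ker,
    AlgHom.toLinearMap_apply]
  constructor
  · intro h φ
    have := h (FreeAlgebra.lift K fun n => if h : n < d then φ (FreeAlgebra.ι K ⟨n, h⟩) else 0)
    rw [← this, ← AlgHom.comp_apply]
    congr 1
    ext i
    simp [embedFree]
  · intro h φ
    exact h (φ.comp (embedFree K d))

/-- The retraction. -/
def retr (K : Type*) [Field K] (d : ℕ) : FreeAlgebra K ℕ →ₐ[K] FreeAlgebra K (Fin d) :=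
  FreeAlgebra.lift K fun n => if h : n < d then FreeAlgebra.ι K ⟨n, h⟩ else 0

theorem retr_embed (f : FreeAlgebra K (Fin d)) : retr K d (embedFree K d f) = f := by
  rw [← AlgHom.comp_apply]
  conv_rhs => rw [← AlgHom.id_apply (R := K) f]
  congr 1
  ext i
  simp [embedFree, retr]

theorem retr_mem {R : Type*} [Ring R] [Algebra K R] {f : FreeAlgebra K ℕ} (hf : f ∈ Tideal K R) :
    retr K d f ∈ TidealD K d R := by
  rw [mem_TidealD]
  intro φ
  simp only [Tideal, Submodule.mem_iInf, LinearMap.mem_ker, AlgHom.toLinearMap_apply] at hf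
  exact hf (φ.comp (retr K d))

theorem TidealD_mul {R R₁ R₂ : Type*} [Ring R] [Algebra K R] [Ring R₁] [Algebra K R₁] [Ring R₂]
    [Algebra K R₂] (hT : Tideal K R = Tideal K R₁ * Tideal K R₂) :
    TidealD K d R = TidealD K d R₁ * TidealD K d R₂ := by
  apply le_antisymm
  · intro f hf
    have h : Tideal K R ≤ (TidealD K d R₁ * TidealD K d R₂).comap (retr K d).toLinearMap := by
      rw [hT, Submodule.mul_le]
      intro x hx y hy
      rw [Submodule.mem_comap, AlgHom.toLinearMap_apply, map_mul]
      exact Submodule.mul_mem_mul (retr_mem hx) (retr_mem hy)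
    have := h hf
    rwa [Submodule.mem_comap, AlgHom.toLinearMap_apply, AlgHom.toLinearMap_apply,
      retr_embed] at this
  · rw [Submodule.mul_le]
    intro x hx y hy
    rw [TidealD, Submodule.mem_comap, AlgHom.toLinearMap_apply, map_mul, hT]
    exact Submodule.mul_mem_mul hx hy

theorem scale_wd (c : Fin d → K) (w : List (Fin d)) :
    FreeAlgebra.lift K (fun i => c i • FreeAlgebra.ι K i) (wd K d w) =
      ((dg w).prod fun i n => c i ^ n) • wd K d w := by
  induction w with
  | nil => simp [wd, dg]
  | cons a w ih =>
    rw [← List.singleton_append, wd_append, map_mul, ih, dg_append, dg_singleton,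
      Finsupp.prod_add_index' (by simp) (by intros; rw [pow_add]), wd_singleton,
      FreeAlgebra.lift_ι_apply, smul_mul_smul_comm]
    simp

theorem homog_TidealD (R : Type*) [Ring R] [Algebra K R] : Homog (TidealD K d R) := by
  intro f hf ν
  by_contra hx
  obtain ⟨ℓ, h1, h2⟩ := Submodule.exists_dual_map_eq_bot_of_notMem hx inferInstance
  apply h1
  have hℓ : ∀ g ∈ TidealD K d R, ℓ g = 0 := by
    intro g hg
    have : ℓ g ∈ (TidealD K d R).map ℓ := ⟨g, hg, rfl⟩
    rwa [h2, Submodule.mem_bot] at this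
  let p : FreeAlgebra K (Fin d) →ₗ[K] MvPolynomial (Fin d) K :=
    (Bw K d).constr K (fun w => MvPolynomial.monomial (dg w) (ℓ (wd K d w)))
  have pw : ∀ w, p (wd K d w) = MvPolynomial.monomial (dg w) (ℓ (wd K d w)) := by
    intro w
    rw [← Bw_apply, Module.Basis.constr_basis, Bw_apply]
  have hev : ∀ c g, MvPolynomial.eval c (p g) =
      ℓ (FreeAlgebra.lift K (fun i => c i • FreeAlgebra.ι K i) g) := by
    intro c g
    induction g using wd_induction with
    | h0 => simp
    | hadd x y hx hy => simp only [map_add, hx, hy]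
    | hsmul a x hx => simp only [map_smul, MvPolynomial.smul_eval, hx, smul_eq_mul]
    | hw w => rw [pw, scale_wd, MvPolynomial.eval_monomial, map_smul, smul_eq_mul, mul_comm]
  have hco : ∀ g, MvPolynomial.coeff ν (p g) = ℓ (comp K d ν g) := by
    intro g
    induction g using wd_induction with
    | h0 => simp
    | hadd x y hx hy => simp only [map_add, MvPolynomial.coeff_add, hx, hy]
    | hsmul a x hx => simp only [map_smul, MvPolynomial.coeff_smul, hx]
    | hw w => rw [pw, comp_wd, MvPolynomial.coeff_monomial]; split_ifs <;> simp
  have hp : p f = 0 := by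
    apply MvPolynomial.funext
    intro c
    rw [hev, map_zero]
    apply hℓ
    rw [mem_TidealD] at hf ⊢
    intro φ
    exact hf (φ.comp _)
  rw [← hco, hp, MvPolynomial.coeff_zero]

theorem relFree_eq (R : Type*) [Ring R] [Algebra K R] :
    relFreeHilbert K d R = hilbertSeriesOf K d ⊤ - hilbertSeriesOf K d (TidealD K d R) := by
  rw [eq_sub_iff_add_eq]
  ext ν
  rw [map_add]
  change (Module.finrank K ↥((homComponent K d ν).map (TidealD K d R).mkQ) : ℚ) +
    (Module.finrank K ↥(TidealD K d R ⊓ homComponent K d ν) : ℚ) =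
    (Module.finrank K ↥(⊤ ⊓ homComponent K d ν) : ℚ)
  rw [top_inf_eq]
  have h := LinearMap.finrank_range_add_finrank_ker
    ((TidealD K d R).mkQ.domRestrict (homComponent K d ν))
  rw [LinearMap.range_domRestrict] at h
  rw [← h]
  push_cast
  congr 2
  rw [LinearMap.ker_domRestrict, Submodule.ker_mkQ, inf_comm,
    ← Submodule.map_comap_subtype]
  exact (LinearEquiv.finrank_eq (Submodule.equivMapOfInjective _
    (Submodule.subtype_injective _) _)).symm

end graded

end

end Aux

/-- If `T(R) = T(R₁)·T(R₂)`, then for every `d ≥ 1`,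
`H(F_d(R)) = H(F_d(R₁)) + H(F_d(R₂)) + (t₁+⋯+t_d - 1)·H(F_d(R₁))·H(F_d(R₂))`. -/
theorem stmt1 (K : Type*) [Field K] [CharZero K]
    (R R₁ R₂ : Type*) [Ring R] [Algebra K R] [Ring R₁] [Algebra K R₁] [Ring R₂] [Algebra K R₂]
    (hT : Tideal K R = Tideal K R₁ * Tideal K R₂)
    (d : ℕ) (hd : 1 ≤ d) :
    relFreeHilbert K d R =
      relFreeHilbert K d R₁ + relFreeHilbert K d R₂ +
        ((∑ i : Fin d, (MvPowerSeries.X i : MvPowerSeries (Fin d) ℚ)) - 1) *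
          relFreeHilbert K d R₁ * relFreeHilbert K d R₂ := by
  have h1 := Aux.hilb_mul (Aux.homog_TidealD (K := K) (d := d) R₁)
    (Aux.homog_TidealD (K := K) (d := d) R₂)
    (fun f hf g => by
      rw [Aux.mem_TidealD] at hf ⊢
      intro φ
      rw [map_mul, hf, zero_mul])
    (fun f hf g => by
      rw [Aux.mem_TidealD] at hf ⊢
      intro φ
      rw [map_mul, hf, mul_zero])
  rw [← Aux.TidealD_mul hT] at h1
  have h2 : hilbertSeriesOf K d ⊤ *
      (1 - ∑ i : Fin d, (MvPowerSeries.X i : MvPowerSeries (Fin d) ℚ)) = 1 := by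
    have := Aux.gf_words (d := d)
    rw [← Aux.hilb_top (K := K)] at this
    linear_combination this
  rw [Aux.relFree_eq, Aux.relFree_eq, Aux.relFree_eq]
  generalize hilbertSeriesOf K d ⊤ = h at *
  generalize hilbertSeriesOf K d (TidealD K d R) = x at *
  generalize hilbertSeriesOf K d (TidealD K d R₁) = a at *
  generalize hilbertSeriesOf K d (TidealD K d R₂) = b at *
  generalize (∑ i : Fin d, (MvPowerSeries.X i : MvPowerSeries (Fin d) ℚ)) = t at *
  linear_combination (t - 1) * h1 + (h - a - b + x) * h2
end

section
/- Let R₁,…,R_n and R be unital associative K-algebras such that T(R) = T(R₁)⋯T(R_n), let σ be a permutation of {1,…,n}, and let R_σ be an algebra with T(R_σ) = T(R_{σ(1)})⋯T(R_{σ(n)}). Then for every d ≥ 1 the Hilbert series of the relatively free algebras coincide: H(F_d(R_σ); t₁,…,t_d) = H(F_d(R); t₁,…,t_d). -/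
open scoped BigOperators
open MvPowerSeries

namespace HilbProof

open Module

section Free

variable (K : Type*) [Field K] {d : ℕ}

/-- The monomial attached to a word. -/
noncomputable def mon (w : List (Fin d)) : FreeAlgebra K (Fin d) :=
  (w.map (FreeAlgebra.ι K)).prod

/-- The multidegree of a word. -/
noncomputable def wdeg (w : List (Fin d)) : Fin d →₀ ℕ :=
  (w.map (fun i => Finsupp.single i 1)).sum

theorem wdeg_apply (w : List (Fin d)) (i : Fin d) : wdeg w i = w.count i := by
  induction w with
  | nil => simp [wdeg]
  | cons j w ih =>
    have : wdeg (j :: w) = Finsupp.single j 1 + wdeg w := by simp [wdeg]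
    rw [this, Finsupp.add_apply, ih, List.count_cons, Finsupp.single_apply, add_comm]
    simp

theorem wdeg_cons (j : Fin d) (w : List (Fin d)) :
    wdeg (j :: w) = Finsupp.single j 1 + wdeg w := by simp [wdeg]

theorem wdeg_sum (w : List (Fin d)) : ∑ i, wdeg w i = w.length := by
  induction w with
  | nil => simp [wdeg]
  | cons j w ih => simp [wdeg_cons, Finset.sum_add_distrib, ih, add_comm, Finsupp.single_apply]

theorem wdeg_append (v w : List (Fin d)) : wdeg (v ++ w) = wdeg v + wdeg w := by
  simp [wdeg]

theorem wdeg_eq_iff (w : List (Fin d)) (ν : Fin d →₀ ℕ) :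
    wdeg w = ν ↔ ∀ i, w.count i = ν i := by
  simp [Finsupp.ext_iff, wdeg_apply]

theorem mon_nil : mon K ([] : List (Fin d)) = 1 := by simp [mon]

theorem mon_cons (j : Fin d) (w : List (Fin d)) :
    mon K (j :: w) = FreeAlgebra.ι K j * mon K w := by simp [mon]

theorem mon_append (v w : List (Fin d)) : mon K (v ++ w) = mon K v * mon K w := by
  simp [mon]

/-- The basis of monomials. -/
noncomputable def mb : Basis (List (Fin d)) K (FreeAlgebra K (Fin d)) :=
  (FreeAlgebra.basisFreeMonoid K (Fin d)).reindex FreeMonoid.toList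

theorem mb_apply (w : List (Fin d)) : mb K w = mon K w := by
  simp only [mb, FreeAlgebra.basisFreeMonoid, Basis.reindex_apply, Basis.map_apply]
  simp [FreeAlgebra.equivMonoidAlgebraFreeMonoid, mon, FreeMonoid.lift_apply]

theorem mon_induction {p : FreeAlgebra K (Fin d) → Prop} (f : FreeAlgebra K (Fin d))
    (h0 : p 0) (hadd : ∀ f g, p f → p g → p (f + g)) (hs : ∀ (c : K) f, p f → p (c • f))
    (hm : ∀ w, p (mon K w)) : p f := by
  have : f ∈ Submodule.span K (Set.range (mb K (d := d))) := by simp [Basis.span_eq]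
  induction this using Submodule.span_induction with
  | mem x hx => obtain ⟨w, rfl⟩ := hx; rw [mb_apply]; exact hm w
  | zero => exact h0
  | add x y _ _ hx hy => exact hadd _ _ hx hy
  | smul c x _ hx => exact hs _ _ hx

theorem lin_ext {M : Type*} [AddCommGroup M] [Module K M] {f g : FreeAlgebra K (Fin d) →ₗ[K] M}
    (h : ∀ w, f (mon K w) = g (mon K w)) : f = g :=
  (mb K).ext fun w => by simpa [mb_apply] using h w

/-- Projection on the multihomogeneous component. -/
noncomputable def P (ν : Fin d →₀ ℕ) : FreeAlgebra K (Fin d) →ₗ[K] FreeAlgebra K (Fin d) :=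
  (mb K).constr K fun w => if wdeg w = ν then mon K w else 0

theorem P_mon (ν : Fin d →₀ ℕ) (w : List (Fin d)) :
    P K ν (mon K w) = if wdeg w = ν then mon K w else 0 := by
  rw [← mb_apply, P, Basis.constr_basis, mb_apply]

/-- Left cancellation of a generator. -/
noncomputable def del (i : Fin d) : FreeAlgebra K (Fin d) →ₗ[K] FreeAlgebra K (Fin d) :=
  (mb K).constr K fun w => match w with
    | [] => 0
    | j :: w => if j = i then mon K w else 0

theorem del_nil (i : Fin d) : del K i 1 = 0 := by
  rw [← mon_nil, ← mb_apply, del, Basis.constr_basis]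

theorem del_cons (i j : Fin d) (w) : del K i (mon K (j :: w)) = if j = i then mon K w else 0 := by
  rw [← mb_apply, del, Basis.constr_basis]

theorem del_mul (i j : Fin d) (f) :
    del K i (FreeAlgebra.ι K j * f) = if j = i then f else 0 := by
  have : (del K i) ∘ₗ (LinearMap.mulLeft K (FreeAlgebra.ι K j)) =
      if j = i then LinearMap.id else 0 := by
    apply lin_ext
    intro w
    simp only [LinearMap.comp_apply, LinearMap.mulLeft_apply, ← mon_cons, del_cons]
    split_ifs <;> simp
  have h := LinearMap.congr_fun this f
  simp only [LinearMap.comp_apply, LinearMap.mulLeft_apply] at h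
  rw [h]; split_ifs <;> simp

/-- Coefficient of a word. -/
noncomputable def cf (w : List (Fin d)) : FreeAlgebra K (Fin d) →ₗ[K] K := (mb K).coord w

theorem cf_mon (v w : List (Fin d)) : cf K v (mon K w) = if w = v then 1 else 0 := by
  rw [← mb_apply, cf, Basis.coord_apply, Basis.repr_self, Finsupp.single_apply]

theorem cf_ext {f : FreeAlgebra K (Fin d)} (h : ∀ w, cf K w f = 0) : f = 0 :=
  (mb K).ext_elem fun w => by simpa [cf] using h w

theorem cf_cons (i : Fin d) (w) (f) : cf K (i :: w) f = cf K w (del K i f) := by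
  have : cf K (i :: w) = cf K w ∘ₗ del K i := by
    apply lin_ext
    intro v
    cases v with
    | nil => rw [LinearMap.comp_apply, mon_nil, del_nil, ← mon_nil, cf_mon]; simp
    | cons j v =>
      rw [LinearMap.comp_apply, del_cons, cf_mon]
      by_cases h : j = i <;> simp [h, cf_mon]
  rw [this]; rfl

theorem decomp (f : FreeAlgebra K (Fin d)) :
    f = cf K [] f • 1 + ∑ i, FreeAlgebra.ι K i * del K i f := by
  have : LinearMap.id = (cf K []).smulRight (1 : FreeAlgebra K (Fin d)) +
      ∑ i, (LinearMap.mulLeft K (FreeAlgebra.ι K i)) ∘ₗ del K i := by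
    apply lin_ext
    intro v
    cases v with
    | nil => simp [cf_mon]; simp [mon_nil, del_nil]
    | cons j v =>
      have h0 : cf K [] (mon K (j :: v)) = 0 := by simp [cf_mon]
      simp [h0, del_cons]
      simp [mon_cons]
  have h := LinearMap.congr_fun this f
  simpa using h

theorem P_mul (i : Fin d) (ν : Fin d →₀ ℕ) (f) :
    P K (Finsupp.single i 1 + ν) (FreeAlgebra.ι K i * f) = FreeAlgebra.ι K i * P K ν f := by
  have : P K (Finsupp.single i 1 + ν) ∘ₗ (LinearMap.mulLeft K (FreeAlgebra.ι K i)) =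
      (LinearMap.mulLeft K (FreeAlgebra.ι K i)) ∘ₗ P K ν := by
    apply lin_ext
    intro w
    simp only [LinearMap.comp_apply, LinearMap.mulLeft_apply, ← mon_cons, P_mon, wdeg_cons,
      add_right_inj]
    split_ifs <;> simp [mon_cons]
  exact LinearMap.congr_fun this f

theorem P_mul_zero (i : Fin d) (ν : Fin d →₀ ℕ) (h : ν i = 0) (f) :
    P K ν (FreeAlgebra.ι K i * f) = 0 := by
  have : P K ν ∘ₗ (LinearMap.mulLeft K (FreeAlgebra.ι K i)) = 0 := by
    apply lin_ext
    intro w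
    simp only [LinearMap.comp_apply, LinearMap.mulLeft_apply, ← mon_cons, P_mon, wdeg_cons]
    rw [if_neg]; · rfl
    rintro rfl
    simp at h
  exact LinearMap.congr_fun this f

theorem sum_P (f : FreeAlgebra K (Fin d)) :
    ∃ s : Finset (Fin d →₀ ℕ), ∀ t, s ⊆ t → ∑ ν ∈ t, P K ν f = f := by
  classical
  induction f using mon_induction K with
  | h0 => exact ⟨∅, by simp⟩
  | hadd f g hf hg =>
    obtain ⟨s, hs⟩ := hf
    obtain ⟨s', hs'⟩ := hg
    refine ⟨s ∪ s', fun t ht => ?_⟩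
    simp only [map_add, Finset.sum_add_distrib]
    rw [hs t (Finset.union_subset_left ht), hs' t (Finset.union_subset_right ht)]
  | hs c f hf =>
    obtain ⟨s, hs⟩ := hf
    refine ⟨s, fun t ht => ?_⟩
    simp only [map_smul, ← Finset.smul_sum]
    rw [hs t ht]
  | hm w =>
    refine ⟨{wdeg w}, fun t ht => ?_⟩
    simp only [P_mon, Finset.sum_ite_eq]
    rw [if_pos (ht (by simp))]

theorem mem_of_P {S : Submodule K (FreeAlgebra K (Fin d))} {f} (h : ∀ ν, P K ν f ∈ S) : f ∈ S := by
  obtain ⟨s, hs⟩ := sum_P K f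
  rw [← hs s (Finset.Subset.refl _)]
  exact Submodule.sum_mem _ fun ν _ => h ν

end Free

section Hom

variable (K : Type*) [Field K] {d : ℕ}

theorem hom_eq (ν : Fin d →₀ ℕ) :
    homComponent K d ν = Submodule.span K (Set.image (mon K) {w | wdeg w = ν}) := by
  unfold homComponent
  congr 1
  ext x
  simp only [Set.mem_ofPred_eq, Set.mem_image, wdeg_eq_iff]
  exact ⟨fun ⟨w, h, e⟩ => ⟨w, h, e.symm⟩, fun ⟨w, h, e⟩ => ⟨w, h, e.symm⟩⟩

theorem mon_mem_hom (w : List (Fin d)) : mon K w ∈ homComponent K d (wdeg w) := by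
  rw [hom_eq]; exact Submodule.subset_span ⟨w, rfl, rfl⟩

theorem P_mem (ν : Fin d →₀ ℕ) (f) : P K ν f ∈ homComponent K d ν := by
  induction f using mon_induction K with
  | h0 => simp
  | hadd f g hf hg => rw [map_add]; exact add_mem hf hg
  | hs c f hf => rw [map_smul]; exact Submodule.smul_mem _ _ hf
  | hm w =>
    rw [P_mon]; split_ifs with h
    · subst h; exact mon_mem_hom K w
    · exact zero_mem _

theorem P_hom {ν μ : Fin d →₀ ℕ} {f} (hf : f ∈ homComponent K d μ) :
    P K ν f = if μ = ν then f else 0 := by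
  rw [hom_eq] at hf
  induction hf using Submodule.span_induction with
  | mem x hx => obtain ⟨w, rfl, rfl⟩ := hx; exact P_mon K ν w
  | zero => simp
  | add x y _ _ hx hy => rw [map_add, hx, hy]; split_ifs <;> simp
  | smul c x _ hx => rw [map_smul, hx]; split_ifs <;> simp

theorem hom_mul {ν μ : Fin d →₀ ℕ} {f g} (hf : f ∈ homComponent K d ν)
    (hg : g ∈ homComponent K d μ) : f * g ∈ homComponent K d (ν + μ) := by
  have : homComponent K d ν * homComponent K d μ ≤ homComponent K d (ν + μ) := by
    rw [hom_eq, hom_eq, Submodule.span_mul_span, Submodule.span_le]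
    rintro _ ⟨_, ⟨v, rfl, rfl⟩, _, ⟨w, rfl, rfl⟩, rfl⟩
    simp only [← mon_append, ← wdeg_append]
    exact mon_mem_hom K _
  exact this (Submodule.mul_mem_mul hf hg)

instance hom_fin (ν : Fin d →₀ ℕ) : Module.Finite K (homComponent K d ν) := by
  rw [hom_eq]
  have : {w : List (Fin d) | wdeg w = ν}.Finite := by
    refine (List.finite_length_eq (Fin d) (∑ i, ν i)).subset ?_
    rintro w rfl
    exact (wdeg_sum w).symm
  exact Module.Finite.span_of_finite K (this.image _)

end Hom

section Graded

universe u

variable (K : Type u) [Field K] {d : ℕ}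

/-- A submodule spanned by its multihomogeneous elements. -/
def Gr (U : Submodule K (FreeAlgebra K (Fin d))) : Prop :=
  U ≤ Submodule.span K {f | f ∈ U ∧ ∃ ν, f ∈ homComponent K d ν}

/-- Multihomogeneous bases. -/
structure HB {I : Type*} (U : Submodule K (FreeAlgebra K (Fin d)))
    (b : I → FreeAlgebra K (Fin d)) (δ : I → Fin d →₀ ℕ) : Prop where
  li : LinearIndependent K b
  span : Submodule.span K (Set.range b) = U
  hom : ∀ i, b i ∈ homComponent K d (δ i)

theorem HB.count {I : Type*} {U : Submodule K (FreeAlgebra K (Fin d))}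
    {b : I → FreeAlgebra K (Fin d)} {δ : I → Fin d →₀ ℕ} (h : HB K U b δ) (ν : Fin d →₀ ℕ) :
    Finite {i // δ i = ν} ∧
      Module.finrank K ↥(U ⊓ homComponent K d ν) = Nat.card {i // δ i = ν} := by
  have li : LinearIndependent K (fun i : {i // δ i = ν} => b i) :=
    h.li.comp _ Subtype.val_injective
  have hs : U ⊓ homComponent K d ν =
      Submodule.span K (Set.range fun i : {i // δ i = ν} => b i) := by
    apply le_antisymm
    · rintro f ⟨hf, hf'⟩
      have e : P K ν f = f := by rw [P_hom K hf', if_pos rfl]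
      rw [← e]
      clear e hf'
      have hf2 : f ∈ U := hf
      clear hf
      rw [← h.span] at hf2
      rename' hf2 => hf
      induction hf using Submodule.span_induction with
      | mem x hx =>
        obtain ⟨i, rfl⟩ := hx
        rw [P_hom K (h.hom i)]
        split_ifs with hi
        · exact Submodule.subset_span ⟨⟨i, hi⟩, rfl⟩
        · exact zero_mem _
      | zero => simp
      | add x y _ _ hx hy => rw [map_add]; exact add_mem hx hy
      | smul c x _ hx => rw [map_smul]; exact Submodule.smul_mem _ _ hx
    · rw [Submodule.span_le]
      rintro _ ⟨⟨i, rfl⟩, rfl⟩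
      refine ⟨?_, h.hom i⟩
      rw [← h.span]
      exact Submodule.subset_span ⟨i, rfl⟩
  have fin : Module.Finite K ↥(U ⊓ homComponent K d ν) :=
    Submodule.finiteDimensional_of_le inf_le_right
  rw [hs] at fin ⊢
  exact ⟨Module.Finite.finite_basis (Basis.span li), Module.finrank_eq_nat_card_basis (Basis.span li)⟩

theorem exists_rel (U Q : Submodule K (FreeAlgebra K (Fin d))) (hU : Gr K U) :
    ∃ (J : Type u) (w : J → FreeAlgebra K (Fin d)) (δ : J → Fin d →₀ ℕ),
      (∀ j, w j ∈ U) ∧ (∀ j, w j ∈ homComponent K d (δ j)) ∧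
      LinearIndependent K (fun j => Q.mkQ (w j)) ∧ U ≤ Submodule.span K (Set.range w) ⊔ Q := by
  obtain ⟨b, hb, hspan, hli⟩ := exists_linearIndependent K
    (Set.image Q.mkQ {f | f ∈ U ∧ ∃ ν, f ∈ homComponent K d ν})
  have hb' : ∀ j : b, ∃ f ν, f ∈ U ∧ f ∈ homComponent K d ν ∧ Q.mkQ f = j := by
    rintro ⟨j, hj⟩
    obtain ⟨f, ⟨hf, ν, hν⟩, e⟩ := hb hj
    exact ⟨f, ν, hf, hν, e⟩
  choose w δ hw hδ he using hb'
  refine ⟨b, w, δ, hw, hδ, ?_, ?_⟩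
  · simp only [he]; exact hli
  · have h1 : U.map Q.mkQ ≤ (Submodule.span K (Set.range w)).map Q.mkQ := by
      refine (Submodule.map_mono hU).trans ?_
      rw [Submodule.map_span, Submodule.map_span, ← hspan, Submodule.span_le]
      intro x hx
      refine Submodule.subset_span ⟨w ⟨x, hx⟩, ⟨_, rfl⟩, he _⟩
    intro f hf
    obtain ⟨g, hg, e⟩ := h1 (Submodule.mem_map_of_mem hf)
    have : f - g ∈ Q := by
      rw [← Submodule.Quotient.mk_eq_zero, Submodule.Quotient.mk_sub, sub_eq_zero]
      exact e.symm
    rw [Submodule.mem_sup]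
    exact ⟨g, hg, f - g, this, by abel⟩

theorem exists_HB (U : Submodule K (FreeAlgebra K (Fin d))) (hU : Gr K U) :
    ∃ (I : Type u) (b : I → FreeAlgebra K (Fin d)) (δ : I → Fin d →₀ ℕ), HB K U b δ := by
  obtain ⟨J, w, δ, hw, hδ, hli, hs⟩ := exists_rel K U ⊥ hU
  refine ⟨J, w, δ, LinearIndependent.of_comp (Submodule.mkQ ⊥) hli, le_antisymm ?_ (by simpa using hs), hδ⟩
  rw [Submodule.span_le]; rintro _ ⟨j, rfl⟩; exact hw j

/-- Span of the generators. -/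
noncomputable def E (d : ℕ) : Submodule K (FreeAlgebra K (Fin d)) :=
  Submodule.span K (Set.range (FreeAlgebra.ι K))

/-- The map `(f_j) ↦ ∑ f_j w_j`. -/
noncomputable def L {J : Type*} (w : J → FreeAlgebra K (Fin d)) :
    (J →₀ FreeAlgebra K (Fin d)) →ₗ[K] FreeAlgebra K (Fin d) :=
  Finsupp.lsum K fun j => LinearMap.mulRight K (w j)

theorem L_single {J : Type*} (w : J → FreeAlgebra K (Fin d)) (j f) :
    L K w (Finsupp.single j f) = f * w j := by
  simp [L]

theorem L_decomp {J : Type*} (w : J → FreeAlgebra K (Fin d)) (f) :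
    L K w f = Finsupp.linearCombination K w (Finsupp.mapRange.linearMap (cf K []) f) +
      ∑ i, FreeAlgebra.ι K i * L K w (Finsupp.mapRange.linearMap (del K i) f) := by
  induction f using Finsupp.induction_linear with
  | zero => simp
  | add f g hf hg =>
    rw [map_add, hf, hg]
    simp only [map_add, mul_add, Finset.sum_add_distrib]
    abel
  | single j a =>
    simp only [Finsupp.mapRange.linearMap_apply, Finsupp.mapRange_single, L_single,
      Finsupp.linearCombination_single]
    conv_lhs => rw [decomp K a]
    simp [add_mul, Finset.sum_mul, mul_assoc]

theorem L_mem {J : Type*} {w : J → FreeAlgebra K (Fin d)} {V : Submodule K (FreeAlgebra K (Fin d))}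
    (hV : ⊤ * V ≤ V) (hw : ∀ j, w j ∈ V) (f) : L K w f ∈ V := by
  induction f using Finsupp.induction_linear with
  | zero => simp
  | add f g hf hg => rw [map_add]; exact add_mem hf hg
  | single j a => rw [L_single]; exact hV (Submodule.mul_mem_mul trivial (hw j))

theorem L_inj {J : Type*} {w : J → FreeAlgebra K (Fin d)} {V : Submodule K (FreeAlgebra K (Fin d))}
    (hV : ⊤ * V ≤ V) (hw : ∀ j, w j ∈ V)
    (hli : LinearIndependent K (fun j => (E K d * V).mkQ (w j))) :
    LinearMap.ker (L K w) = ⊥ := by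
  rw [LinearMap.ker_eq_bot']
  have key : ∀ f, L K w f = 0 → (∀ j, cf K [] (f j) = 0) ∧
      ∀ i, L K w (Finsupp.mapRange.linearMap (del K i) f) = 0 := by
    intro f hf
    rw [L_decomp] at hf
    have h1 : Finsupp.linearCombination K w (Finsupp.mapRange.linearMap (cf K []) f)
        ∈ E K d * V := by
      rw [eq_neg_of_add_eq_zero_left hf]
      refine neg_mem (Submodule.sum_mem _ fun i _ => Submodule.mul_mem_mul ?_ (L_mem K hV hw _))
      exact Submodule.subset_span ⟨i, rfl⟩
    have h2 : Finsupp.mapRange.linearMap (cf K []) f = 0 := by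
      rw [linearIndependent_iff] at hli
      apply hli
      rw [← Submodule.Quotient.mk_eq_zero, ← Submodule.mkQ_apply,
        Finsupp.apply_linearCombination] at h1
      exact h1
    refine ⟨fun j => by simpa using DFunLike.congr_fun h2 j, fun i => ?_⟩
    rw [h2] at hf
    have := congrArg (del K i) hf
    simpa [del_mul] using this
  have : ∀ v : List (Fin d), ∀ f, L K w f = 0 → ∀ j, cf K v (f j) = 0 := by
    intro v
    induction v with
    | nil => exact fun f hf => (key f hf).1
    | cons i v ih =>
      intro f hf j
      rw [cf_cons]
      simpa using ih _ ((key f hf).2 i) j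
  intro f hf
  ext1 j
  exact cf_ext K fun v => this v f hf j

theorem gen {J : Type*} {w : J → FreeAlgebra K (Fin d)} {δ : J → Fin d →₀ ℕ}
    {V : Submodule K (FreeAlgebra K (Fin d))}
    (hδ : ∀ j, w j ∈ homComponent K d (δ j))
    (hs : V ≤ Submodule.span K (Set.range w) ⊔ E K d * V) :
    V ≤ ⊤ * Submodule.span K (Set.range w) := by
  have hT : ∀ f g, g ∈ (⊤ : Submodule K (FreeAlgebra K (Fin d))) * Submodule.span K (Set.range w) →
      f * g ∈ (⊤ : Submodule K (FreeAlgebra K (Fin d))) * Submodule.span K (Set.range w) := by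
    intro f g hg
    have := Submodule.mul_mem_mul (Submodule.mem_top : f ∈ ⊤) hg
    rw [← mul_assoc] at this
    exact (mul_le_mul' le_top le_rfl : _ ≤ (⊤ : Submodule K (FreeAlgebra K (Fin d))) * Submodule.span K (Set.range w)) this
  have : ∀ n, ∀ ν : Fin d →₀ ℕ, ∑ i, ν i = n → ∀ v ∈ V,
      P K ν v ∈ (⊤ : Submodule K (FreeAlgebra K (Fin d))) * Submodule.span K (Set.range w) := by
    intro n
    induction n with
    | zero => ?_
    | succ n ih => ?_
    all_goals
      intro ν hν v hv
      obtain ⟨g, hg, e, he, rfl⟩ := Submodule.mem_sup.1 (hs hv)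
      rw [map_add]
      refine add_mem ?_ ?_
      · clear hv
        induction hg using Submodule.span_induction with
        | mem x hx =>
          obtain ⟨j, rfl⟩ := hx
          rw [P_hom K (hδ j)]
          split_ifs
          · rw [← one_mul (w j)]
            exact Submodule.mul_mem_mul trivial (Submodule.subset_span ⟨j, rfl⟩)
          · exact zero_mem _
        | zero => simp
        | add x y _ _ hx hy => rw [map_add]; exact add_mem hx hy
        | smul c x _ hx => rw [map_smul]; exact Submodule.smul_mem _ _ hx
      · clear hv
        induction he using Submodule.mul_induction_on' with
        | mem_mul_mem x hx y hy =>
          induction hx using Submodule.span_induction with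
          | mem x hx =>
            obtain ⟨i, rfl⟩ := hx
            by_cases h0 : ν i = 0
            · rw [P_mul_zero K i ν h0]; exact zero_mem _
            · have hle : Finsupp.single i 1 ≤ ν := by
                rw [Finsupp.single_le_iff]; omega
              obtain ⟨μ, rfl⟩ := exists_add_of_le hle
              simp [Finset.sum_add_distrib, Finsupp.single_apply] at hν
              try
                rw [P_mul]
                exact hT _ _ (ih μ (by omega) y hy)
          | zero => simp
          | add x y _ _ hx hy => rw [add_mul, map_add]; exact add_mem hx hy
          | smul c x _ hx => rw [smul_mul_assoc, map_smul]; exact Submodule.smul_mem _ _ hx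
        | add x _ y _ hx hy => rw [map_add]; exact add_mem hx hy
  exact fun v hv => mem_of_P K fun ν => this _ ν rfl v hv

theorem HB.mul {I J : Type*} {U V : Submodule K (FreeAlgebra K (Fin d))}
    {u : I → FreeAlgebra K (Fin d)} {ε : I → Fin d →₀ ℕ} (hu : HB K U u ε)
    (hU : U * ⊤ ≤ U) (hV : ⊤ * V ≤ V)
    {w : J → FreeAlgebra K (Fin d)} {δ : J → Fin d →₀ ℕ}
    (hw : ∀ j, w j ∈ V) (hδ : ∀ j, w j ∈ homComponent K d (δ j))
    (hli : LinearIndependent K (fun j => (E K d * V).mkQ (w j)))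
    (hs : V ≤ Submodule.span K (Set.range w) ⊔ E K d * V) :
    HB K (U * V) (fun p : I × J => u p.1 * w p.2) (fun p => ε p.1 + δ p.2) := by
  refine ⟨?_, ?_, fun p => hom_mul K (hu.hom _) (hδ _)⟩
  · have h1 := Finsupp.linearIndependent_single (R := K) (ι := J) (fun _ : J => u) (fun _ => hu.li)
    have h2 : LinearIndependent K (fun p : I × J => Finsupp.single p.2 (u p.1)) :=
      h1.comp (fun p : I × J => (⟨p.2, p.1⟩ : Σ _ : J, I)) (by
        rintro ⟨a, b⟩ ⟨c, e⟩ h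
        simp at h
        simp [h])
    have h3 := h2.map' (L K w) (L_inj K hV hw hli)
    refine (linearIndependent_equiv' (Equiv.refl _) ?_).1 h3
    funext p
    simp [L_single]
  · have h1 : Submodule.span K (Set.range fun p : I × J => u p.1 * w p.2) =
        U * Submodule.span K (Set.range w) := by
      rw [← hu.span, Submodule.span_mul_span]
      congr 1
      ext x
      simp [Set.mem_mul]
    rw [h1]
    apply le_antisymm
    · refine mul_le_mul' le_rfl ?_
      rw [Submodule.span_le]; rintro _ ⟨j, rfl⟩; exact hw j
    · refine (mul_le_mul' le_rfl (gen K hδ hs)).trans ?_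
      rw [← mul_assoc]
      exact mul_le_mul' hU le_rfl

theorem series_mul {I J : Type*} {U W X : Submodule K (FreeAlgebra K (Fin d))}
    {u : I → FreeAlgebra K (Fin d)} {ε : I → Fin d →₀ ℕ} (hu : HB K U u ε)
    {w : J → FreeAlgebra K (Fin d)} {δ : J → Fin d →₀ ℕ} (hw : HB K W w δ)
    {x : I × J → FreeAlgebra K (Fin d)} (hx : HB K X x (fun p => ε p.1 + δ p.2)) :
    hilbertSeriesOf K d X = hilbertSeriesOf K d U * hilbertSeriesOf K d W := by
  classical
  ext ν
  rw [MvPowerSeries.coeff_mul]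
  change ((Module.finrank K ↥(X ⊓ homComponent K d ν) : ℕ) : ℚ) =
    ∑ p ∈ Finset.HasAntidiagonal.antidiagonal ν, ((Module.finrank K ↥(U ⊓ homComponent K d p.1) : ℕ) : ℚ) *
      ((Module.finrank K ↥(W ⊓ homComponent K d p.2) : ℕ) : ℚ)
  simp only [(hx.count K _).2, (hu.count K _).2, (hw.count K _).2]
  have hfu := fun μ => (hu.count K μ).1
  have hfw := fun μ => (hw.count K μ).1
  norm_cast
  let e : {p : I × J // ε p.1 + δ p.2 = ν} ≃
      Σ q : {q // q ∈ Finset.HasAntidiagonal.antidiagonal ν}, {i // ε i = q.1.1} × {j // δ j = q.1.2} :=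
    { toFun := fun p => ⟨⟨(ε p.1.1, δ p.1.2), by simpa using p.2⟩, ⟨p.1.1, rfl⟩, ⟨p.1.2, rfl⟩⟩
      invFun := fun s => ⟨(s.2.1.1, s.2.2.1), by
        have := s.1.2
        rw [Finset.HasAntidiagonal.mem_antidiagonal] at this
        simpa [s.2.1.2, s.2.2.2] using this⟩
      left_inv := fun p => rfl
      right_inv := by
        rintro ⟨⟨⟨a, b⟩, h⟩, ⟨i, hi⟩, ⟨j, hj⟩⟩
        dsimp only at hi hj
        subst hi hj
        rfl }
  rw [Nat.card_congr e, Nat.card_sigma]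
  simp only [Nat.card_prod]
  exact Finset.sum_coe_sort (Finset.HasAntidiagonal.antidiagonal ν)
    (fun q => Nat.card {i // ε i = q.1} * Nat.card {j // δ j = q.2})

/-- Multihomogeneous two-sided ideals. -/
structure Good (U : Submodule K (FreeAlgebra K (Fin d))) : Prop where
  gr : Gr K U
  left : ⊤ * U ≤ U
  right : U * ⊤ ≤ U

theorem Good.left_eq {U : Submodule K (FreeAlgebra K (Fin d))} (h : Good K U) : ⊤ * U = U :=
  le_antisymm h.left fun f hf => by
    rw [← one_mul f]; exact Submodule.mul_mem_mul trivial hf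

theorem Good.right_eq {U : Submodule K (FreeAlgebra K (Fin d))} (h : Good K U) : U * ⊤ = U :=
  le_antisymm h.right fun f hf => by
    rw [← mul_one f]; exact Submodule.mul_mem_mul hf trivial

theorem gr_of_P {U : Submodule K (FreeAlgebra K (Fin d))} (h : ∀ f ∈ U, ∀ ν, P K ν f ∈ U) :
    Gr K U := fun f hf => mem_of_P K fun ν =>
  Submodule.subset_span ⟨h f hf ν, ν, P_mem K ν f⟩

theorem good_top : Good K (⊤ : Submodule K (FreeAlgebra K (Fin d))) :=
  ⟨gr_of_P K fun _ _ _ => trivial, le_top, le_top⟩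

theorem Good.mul {U V : Submodule K (FreeAlgebra K (Fin d))} (hU : Good K U) (hV : Good K V) :
    Good K (U * V) := by
  refine ⟨?_, ?_, ?_⟩
  · refine (mul_le_mul' hU.gr hV.gr).trans ?_
    rw [Submodule.span_mul_span]
    refine Submodule.span_mono ?_
    rintro _ ⟨f, ⟨hf, ν, hν⟩, g, ⟨hg, μ, hμ⟩, rfl⟩
    exact ⟨Submodule.mul_mem_mul hf hg, ν + μ, hom_mul K hν hμ⟩
  · rw [← mul_assoc, hU.left_eq]
  · rw [mul_assoc, hV.right_eq]

theorem main_mul {U V : Submodule K (FreeAlgebra K (Fin d))} (hU : Good K U) (hV : Good K V) :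
    hilbertSeriesOf K d (U * V) * hilbertSeriesOf K d ⊤ =
      hilbertSeriesOf K d U * hilbertSeriesOf K d V := by
  obtain ⟨I, u, ε, hu⟩ := exists_HB K U hU.gr
  obtain ⟨I', u', ε', hu'⟩ := exists_HB K ⊤ (good_top K (d := d)).gr
  obtain ⟨J, w, δ, hw, hδ, hli, hs⟩ := exists_rel K V (E K d * V) hV.gr
  have hW : HB K (Submodule.span K (Set.range w)) w δ :=
    ⟨LinearIndependent.of_comp (Submodule.mkQ _) hli, rfl, hδ⟩
  have h1 := series_mul K hu hW (hu.mul K hU.right hV.left hw hδ hli hs)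
  have h2 := series_mul K hu' hW (hu'.mul K le_top hV.left hw hδ hli hs)
  rw [hV.left_eq] at h2
  rw [h1, h2]
  ring

theorem main_list (l : List (Submodule K (FreeAlgebra K (Fin d)))) (hl : ∀ U ∈ l, Good K U) :
    Good K (l.prod * ⊤) ∧ hilbertSeriesOf K d (l.prod * ⊤) * hilbertSeriesOf K d ⊤ ^ l.length =
      hilbertSeriesOf K d ⊤ * (l.map (hilbertSeriesOf K d)).prod := by
  induction l with
  | nil => simp [good_top K]
  | cons U l ih =>
    obtain ⟨h1, h2⟩ := ih fun V hV => hl V (by simp [hV])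
    have hU := hl U (by simp)
    rw [List.prod_cons, mul_assoc]
    refine ⟨hU.mul K h1, ?_⟩
    have := main_mul K hU h1
    rw [List.length_cons, pow_succ', ← mul_assoc, this, mul_assoc, h2]
    simp only [List.map_cons, List.prod_cons]
    ring

theorem top_ne_zero : hilbertSeriesOf K d ⊤ ≠ 0 := by
  intro h
  have := congrFun h 0
  change ((Module.finrank K ↥((⊤ : Submodule K (FreeAlgebra K (Fin d))) ⊓ homComponent K d 0) : ℕ) : ℚ) = 0 at this
  rw [top_inf_eq, Nat.cast_eq_zero, Submodule.finrank_eq_zero] at this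
  have h1 := mon_mem_hom K ([] : List (Fin d))
  have h0 : wdeg ([] : List (Fin d)) = 0 := by simp [wdeg]
  rw [h0, this, mon_nil] at h1
  simp at h1

end Graded

section TI

variable (K : Type*) [Field K] {d : ℕ}

/-- Retraction of the embedding of free algebras. -/
noncomputable def retr (d : ℕ) : FreeAlgebra K ℕ →ₐ[K] FreeAlgebra K (Fin d) :=
  FreeAlgebra.lift K fun i => if h : i < d then FreeAlgebra.ι K ⟨i, h⟩ else 0

theorem retr_embed (f : FreeAlgebra K (Fin d)) : retr K d (embedFree K d f) = f := by
  have : (retr K d).comp (embedFree K d) = AlgHom.id K _ := by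
    ext i
    simp [retr, embedFree]
  exact DFunLike.congr_fun this f

theorem mem_Tideal {R : Type*} [Ring R] [Algebra K R] {f : FreeAlgebra K ℕ} :
    f ∈ Tideal K R ↔ ∀ φ : FreeAlgebra K ℕ →ₐ[K] R, φ f = 0 := by
  simp [Tideal, Submodule.mem_iInf]

theorem mem_TidealD {R : Type*} [Ring R] [Algebra K R] {f : FreeAlgebra K (Fin d)} :
    f ∈ TidealD K d R ↔ ∀ φ : FreeAlgebra K (Fin d) →ₐ[K] R, φ f = 0 := by
  rw [TidealD, Submodule.mem_comap, AlgHom.toLinearMap_apply, mem_Tideal]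
  constructor
  · intro h φ
    have := h (φ.comp (retr K d))
    simpa [retr_embed] using this
  · intro h φ
    exact h (φ.comp (embedFree K d))

theorem map_Tideal (R : Type*) [Ring R] [Algebra K R] :
    (Tideal K R).map (retr K d).toLinearMap = TidealD K d R := by
  ext f
  constructor
  · rintro ⟨g, hg, rfl⟩
    rw [mem_TidealD]
    intro φ
    exact (mem_Tideal K).1 hg (φ.comp (retr K d))
  · intro hf
    exact ⟨embedFree K d f, hf, retr_embed K f⟩

/-- Rescaling of the generators. -/
noncomputable def theta (a : Fin d → K) : FreeAlgebra K (Fin d) →ₐ[K] FreeAlgebra K (Fin d) :=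
  FreeAlgebra.lift K fun i => a i • FreeAlgebra.ι K i

theorem theta_mon (a : Fin d → K) (w : List (Fin d)) :
    theta K a (mon K w) = (wdeg w).prod (fun i k => a i ^ k) • mon K w := by
  induction w with
  | nil => simp [mon_nil, wdeg]
  | cons j w ih =>
    rw [mon_cons, map_mul, ih, wdeg_cons, Finsupp.prod_add_index' (by simp) (by simp [pow_add]),
      Finsupp.prod_single_index (by simp)]
    simp [theta, smul_smul, mul_comm]

theorem theta_P (a : Fin d → K) (ν : Fin d →₀ ℕ) (f) :
    theta K a (P K ν f) = ν.prod (fun i k => a i ^ k) • P K ν f := by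
  induction f using mon_induction K with
  | h0 => simp
  | hadd f g hf hg => rw [map_add, map_add, hf, hg, smul_add]
  | hs c f hf => rw [map_smul, map_smul, hf, smul_comm]
  | hm w =>
    rw [P_mon]; split_ifs with h
    · rw [theta_mon, h]
    · simp

theorem TidealD_P [CharZero K] {R : Type*} [Ring R] [Algebra K R] {f : FreeAlgebra K (Fin d)}
    (hf : f ∈ TidealD K d R) (ν : Fin d →₀ ℕ) : P K ν f ∈ TidealD K d R := by
  classical
  rw [mem_TidealD] at hf ⊢
  intro φ
  rw [← Module.forall_dual_apply_eq_zero_iff K]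
  intro l
  obtain ⟨s, hs⟩ := sum_P K f
  have hs := hs (insert ν s) (Finset.subset_insert _ _)
  have hp : ∑ μ ∈ insert ν s, MvPolynomial.monomial μ (l (φ (P K μ f))) = 0 := by
    apply MvPolynomial.funext
    intro a
    have h := hf (φ.comp (theta K a))
    rw [AlgHom.comp_apply, ← hs, map_sum, map_sum] at h
    have h := congrArg l h
    simp only [theta_P, map_smul, map_sum, map_zero, smul_eq_mul] at h
    simp only [map_sum, MvPolynomial.eval_monomial, map_zero]
    rw [← h]
    exact Finset.sum_congr rfl fun _ _ => mul_comm _ _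
  have := congrArg (MvPolynomial.coeff ν) hp
  simpa [MvPolynomial.coeff_sum, MvPolynomial.coeff_monomial] using this

theorem good_TidealD [CharZero K] (R : Type*) [Ring R] [Algebra K R] :
    Good K (TidealD K d R) := by
  refine ⟨gr_of_P K fun f hf ν => TidealD_P K hf ν, ?_, ?_⟩
  · rw [Submodule.mul_le]
    intro f _ g hg
    rw [mem_TidealD] at hg ⊢
    intro φ; rw [map_mul, hg, mul_zero]
  · rw [Submodule.mul_le]
    intro f hf g _
    rw [mem_TidealD] at hf ⊢
    intro φ; rw [map_mul, hf, zero_mul]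

theorem map_list (l : List (Submodule K (FreeAlgebra K ℕ))) :
    l.prod.map (retr K d).toLinearMap = (l.map (Submodule.map (retr K d).toLinearMap)).prod := by
  induction l with
  | nil => simp [Submodule.map_one]
  | cons U l ih => simp only [List.prod_cons, List.map_cons, Submodule.map_mul, ih]

theorem series_prod [CharZero K] {n : ℕ} (R : Fin n → Type*) [∀ i, Ring (R i)]
    [∀ i, Algebra K (R i)] (R₀ : Type*) [Ring R₀] [Algebra K R₀]
    (hT : Tideal K R₀ = (List.ofFn fun i => Tideal K (R i)).prod) :
    hilbertSeriesOf K d (TidealD K d R₀) * hilbertSeriesOf K d ⊤ ^ n =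
      hilbertSeriesOf K d ⊤ * ∏ i, hilbertSeriesOf K d (TidealD K d (R i)) := by
  have h1 : TidealD K d R₀ = (List.ofFn fun i => TidealD K d (R i)).prod := by
    rw [← map_Tideal, hT, map_list, List.map_ofFn]
    congr 2
    funext i
    exact map_Tideal K (R i)
  have h2 := (main_list K (List.ofFn fun i => TidealD K d (R i)) (by
    intro U hU
    rw [List.mem_ofFn] at hU
    obtain ⟨i, rfl⟩ := hU
    exact good_TidealD K (R i))).2
  rw [← h1, (good_TidealD K R₀).right_eq, List.length_ofFn, List.map_ofFn, List.prod_ofFn] at h2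
  exact h2

theorem relFree_eq (R : Type*) [Ring R] [Algebra K R] (ν : Fin d →₀ ℕ) :
    relFreeHilbert K d R ν + hilbertSeriesOf K d (TidealD K d R) ν =
      (Module.finrank K (homComponent K d ν) : ℚ) := by
  have h := LinearMap.finrank_range_add_finrank_ker
    ((TidealD K d R).mkQ.domRestrict (homComponent K d ν))
  rw [LinearMap.range_domRestrict, LinearMap.ker_domRestrict, Submodule.ker_mkQ] at h
  have e : Module.finrank K ↥((TidealD K d R).submoduleOf (homComponent K d ν)) =
      Module.finrank K ↥(TidealD K d R ⊓ homComponent K d ν) := by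
    rw [← Submodule.finrank_map_subtype_eq, Submodule.submoduleOf, Submodule.map_comap_subtype,
      inf_comm]
  rw [← h]
  unfold relFreeHilbert hilbertSeriesOf
  push_cast
  congr 2
  exact e.symm

end TI

end HilbProof

/-- If `T(R) = T(R₁)⋯T(R_n)` and `T(R_σ) = T(R_{σ(1)})⋯T(R_{σ(n)})` for a
permutation `σ` of `{1,…,n}`, then `H(F_d(R_σ)) = H(F_d(R))` for every `d ≥ 1`. -/
theorem stmt3 (K : Type*) [Field K] [CharZero K]
    (n : ℕ) (R : Fin n → Type*) [∀ i, Ring (R i)] [∀ i, Algebra K (R i)]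
    (R₀ : Type*) [Ring R₀] [Algebra K R₀]
    (hT : Tideal K R₀ = (List.ofFn fun i => Tideal K (R i)).prod)
    (σ : Equiv.Perm (Fin n))
    (Rσ : Type*) [Ring Rσ] [Algebra K Rσ]
    (hTσ : Tideal K Rσ = (List.ofFn fun i => Tideal K (R (σ i))).prod)
    (d : ℕ) (hd : 1 ≤ d) :
    relFreeHilbert K d Rσ = relFreeHilbert K d R₀ := by
  have h1 := HilbProof.series_prod K (d := d) R R₀ hT
  have h2 := HilbProof.series_prod K (d := d) (fun i => R (σ i)) Rσ hTσ
  rw [Equiv.prod_comp σ (fun i => hilbertSeriesOf K d (TidealD K d (R i))), ← h1] at h2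
  have h3 := mul_right_cancel₀ (pow_ne_zero n (HilbProof.top_ne_zero K (d := d))) h2
  funext ν
  have e1 := HilbProof.relFree_eq K (d := d) R₀ ν
  have e2 := HilbProof.relFree_eq K (d := d) Rσ ν
  rw [h3, ← e1] at e2
  exact add_right_cancel e2
end
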